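/- Let t be an integer and G=(X,Y;E) be a bipartite graph with |X|=m and |Y|=n. Suppose that n ≥ m and t ≤ m ≤ 2t−2. If e(G) > (t−1)(n−1)+m, then G contains a cycle of length exactly 2t. -/

import Mathlib

set_option linter.unusedSectionVars false

section Paths

variable {V : Type*} [DecidableEq V] {G : SimpleGraph V}

/-- `PathOn G a b s`: some path of `G` from `a` to `b` has vertex set `s`. -/
inductive PathOn (G : SimpleGraph V) : V → V → Finset V → Prop
  | single (a : V) : PathOn G a a {a}
  | cons {c a b : V} {s : Finset V} :
      G.Adj c a → c ∉ s → PathOn G a b s → PathOn G c b (insert c s)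

/-- `CycleOn G s`: some cycle of `G` has vertex set `s`. -/
def CycleOn (G : SimpleGraph V) (s : Finset V) : Prop :=
  ∃ a b, PathOn G a b s ∧ G.Adj b a ∧ 3 ≤ s.card

namespace PathOn

variable {a b c d u : V} {s s' : Finset V}

lemma left_mem (h : PathOn G a b s) : a ∈ s := by
  cases h <;> simp

lemma right_mem (h : PathOn G a b s) : b ∈ s := by
  induction h with
  | single => simp
  | cons _ _ _ ih => exact Finset.mem_insert_of_mem ih

lemma append (h : PathOn G a b s) (h' : PathOn G c d s') (hbc : G.Adj b c)
    (hd : Disjoint s s') : PathOn G a d (s ∪ s') := by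
  induction h with
  | single a =>
    rw [← Finset.insert_eq]
    exact cons hbc (by simpa using hd) h'
  | cons hadj hn _ ih =>
    rw [Finset.disjoint_insert_left] at hd
    rw [Finset.insert_union]
    exact cons hadj (by simp [hn, hd.1]) (ih hbc hd.2)

lemma symm (h : PathOn G a b s) : PathOn G b a s := by
  induction h with
  | single a => exact single a
  | cons hadj hn _ ih =>
    rw [Finset.insert_eq, Finset.union_comm]
    exact ih.append (single _) hadj.symm (by simpa using hn)

lemma snoc (h : PathOn G a b s) (hbc : G.Adj b c) (hc : c ∉ s) :
    PathOn G a c (insert c s) :=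
  (cons hbc.symm hc h.symm).symm

lemma glue (h : PathOn G a b s) (h' : PathOn G b c s') (hd : ∀ v ∈ s, v ∈ s' → v = b) :
    PathOn G a c (s ∪ s') := by
  induction h with
  | single a => simpa [Finset.insert_eq_of_mem h'.left_mem] using h'
  | @cons e a b s hadj hn h1 ih =>
    rw [Finset.insert_union]
    refine cons hadj ?_ (ih h' fun v hv hv' => hd v (Finset.mem_insert_of_mem hv) hv')
    intro he
    rcases Finset.mem_union.1 he with he | he
    · exact hn he
    · exact hn (hd e (Finset.mem_insert_self _ _) he ▸ h1.right_mem)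

lemma split (h : PathOn G a b s) (hu : u ∈ s) :
    ∃ p q, PathOn G a u p ∧ PathOn G u b q ∧ p ∪ q = s ∧ ∀ v ∈ p, v ∈ q → v = u := by
  induction h with
  | single a =>
    obtain rfl := Finset.mem_singleton.1 hu
    exact ⟨_, _, single _, single _, by simp, by simp⟩
  | @cons e a b s hadj hn h1 ih =>
    rcases eq_or_ne u e with rfl | hue
    · refine ⟨_, _, single _, cons hadj hn h1, by simp, by simp⟩
    · obtain ⟨p, q, hp, hq, rfl, hpq⟩ := ih (Finset.mem_of_mem_insert_of_ne hu hue)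
      refine ⟨_, q, cons hadj (fun h => hn (by simp [h])) hp, hq, by simp, ?_⟩
      intro v hv hvq
      rcases Finset.mem_insert.1 hv with rfl | hv
      · exact absurd (Finset.mem_union_right _ hvq) hn
      · exact hpq v hv hvq

lemma prefix_to (h : PathOn G a b s) (hu : u ∈ s) : ∃ p ⊆ s, PathOn G a u p := by
  obtain ⟨p, q, hp, -, rfl, -⟩ := h.split hu
  exact ⟨p, Finset.subset_union_left, hp⟩

lemma glue_cycle (h : PathOn G a b s) (h' : PathOn G b a s')
    (hd : ∀ v ∈ s, v ∈ s' → v = a ∨ v = b) (hab : a ≠ b) (hc : 3 ≤ (s ∪ s').card) :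
    CycleOn G (s ∪ s') := by
  cases h with
  | single => exact absurd rfl hab
  | @cons _ e _ s1 hadj hn h1 =>
    have h2 := h1.glue h' (fun v hv hv' => by
      rcases hd v (Finset.mem_insert_of_mem hv) hv' with rfl | h
      · exact absurd hv hn
      · exact h)
    have : s1 ∪ s' = insert a s1 ∪ s' := by
      ext v
      simp only [Finset.mem_union, Finset.mem_insert]
      constructor
      · tauto
      · rintro ((rfl | h) | h)
        · exact Or.inr h'.right_mem
        · exact Or.inl h
        · exact Or.inr h
    rw [this] at h2
    exact ⟨_, _, h2, hadj, hc⟩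

lemma close (h : PathOn G a b s) (h' : PathOn G c d s') (hbc : G.Adj b c) (hda : G.Adj d a)
    (hd : Disjoint s s') (hc : 3 ≤ s.card + s'.card) : CycleOn G (s ∪ s') :=
  ⟨a, d, h.append h' hbc hd, hda, by rwa [Finset.card_union_of_disjoint hd]⟩

lemma exists_walk (h : PathOn G a b s) :
    ∃ w : G.Walk a b, w.IsPath ∧ w.length + 1 = s.card ∧ ∀ v ∈ w.support, v ∈ s := by
  induction h with
  | single a => exact ⟨.nil, by simp, by simp, by simp⟩
  | cons hadj hn _ ih =>
    obtain ⟨w, hw, hl, hs⟩ := ih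
    refine ⟨.cons hadj w, ?_, ?_, ?_⟩
    · rw [SimpleGraph.Walk.cons_isPath_iff]
      exact ⟨hw, fun h => hn (hs _ h)⟩
    · rw [SimpleGraph.Walk.length_cons, hl, Finset.card_insert_of_notMem hn]
    · intro v hv
      rw [SimpleGraph.Walk.support_cons, List.mem_cons] at hv
      rcases hv with rfl | hv
      · simp
      · exact Finset.mem_insert_of_mem (hs v hv)

/-- The vertices `w i`, `i ∈ [i, j]`, of an injective sequence of successively adjacent vertices
form a path. -/
lemma segment (w : ℕ → V) {i j : ℕ} (hij : i ≤ j)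
    (hadj : ∀ k, i ≤ k → k < j → G.Adj (w k) (w (k + 1)))
    (hinj : ∀ k l, i ≤ k → k < l → l ≤ j → w k ≠ w l) :
    PathOn G (w i) (w j) ((Finset.Icc i j).image w) := by
  induction j, hij using Nat.le_induction with
  | base => simpa using single (w i)
  | succ j hij ih =>
    have h := ih (fun k h1 h2 => hadj k h1 (by omega)) fun k l h1 h2 h3 => hinj k l h1 h2 (by omega)
    have h' := h.snoc (hadj j hij (by omega)) (by
      simp only [Finset.mem_image, Finset.mem_Icc, not_exists, not_and]
      exact fun k hk => hinj k (j + 1) hk.1 (by omega) le_rfl)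
    rw [← Finset.image_insert] at h'
    convert h' using 2
    ext k
    simp only [Finset.mem_Icc, Finset.mem_insert]
    omega

lemma exists_seq (h : PathOn G a b s) :
    ∃ w : ℕ → V, w 0 = a ∧ w (s.card - 1) = b ∧ (∀ i, i + 1 < s.card → G.Adj (w i) (w (i + 1))) ∧
      (∀ i j, i < j → j < s.card → w i ≠ w j) ∧ (Finset.range s.card).image w = s := by
  induction h with
  | single a => exact ⟨fun _ => a, by simp, by simp, by simp, by simp; omega, by simp⟩
  | @cons c a b s hadj hn h1 ih =>
    obtain ⟨w, h0, hl, ha, hi, hs⟩ := ih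
    have hpos : 0 < s.card := Finset.card_pos.2 ⟨_, h1.left_mem⟩
    have hmem : ∀ i < s.card, w i ∈ s := fun i hi => by
      rw [← hs]; exact Finset.mem_image_of_mem _ (by simpa using hi)
    rw [Finset.card_insert_of_notMem hn]
    refine ⟨fun i => Nat.casesOn i c w, rfl, ?_, ?_, ?_, ?_⟩
    · obtain ⟨k, hk⟩ : ∃ k, s.card = k + 1 := ⟨s.card - 1, by omega⟩
      rw [hk] at hl ⊢
      simpa using hl
    · rintro (_ | i) hi
      · simpa [h0] using hadj
      · exact ha i (by omega)
    · rintro (_ | i) (_ | j) hij hj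
      · omega
      · intro (h : c = w j)
        exact hn (h ▸ hmem j (by omega))
      · omega
      · exact hi i j (by omega) (by omega)
    · ext v
      simp only [Finset.mem_image, Finset.mem_range, Finset.mem_insert]
      constructor
      · rintro ⟨_ | i, hi, rfl⟩
        · exact Or.inl rfl
        · exact Or.inr (hmem i (by omega))
      · rintro (rfl | hv)
        · exact ⟨0, by omega, rfl⟩
        · rw [← hs] at hv
          obtain ⟨i, hi, rfl⟩ := Finset.mem_image.1 hv
          exact ⟨i + 1, by simpa using hi, rfl⟩

end PathOn

/-- `v` runs periodically around a cycle of length `n`. -/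
structure IsCyclicSeq (G : SimpleGraph V) (v : ℕ → V) (n : ℕ) : Prop where
  three_le : 3 ≤ n
  adj : ∀ i, G.Adj (v i) (v (i + 1))
  periodic : ∀ i, v (i + n) = v i
  ne : ∀ i j, i < j → j < i + n → v i ≠ v j

namespace IsCyclicSeq

variable {v : ℕ → V} {n : ℕ}

lemma shift (h : IsCyclicSeq G v n) (a : ℕ) : IsCyclicSeq G (fun i => v (a + i)) n where
  three_le := h.three_le
  adj i := h.adj (a + i)
  periodic i := by rw [← add_assoc, h.periodic]
  ne i j hij hj := h.ne _ _ (by omega) (by omega)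

lemma mod_eq (h : IsCyclicSeq G v n) (i : ℕ) : v (i % n) = v i :=
  Function.Periodic.map_mod_nat (f := v) h.periodic i

lemma segment (h : IsCyclicSeq G v n) {i j : ℕ} (hij : i ≤ j) (hj : j < i + n) :
    PathOn G (v i) (v j) ((Finset.Icc i j).image v) :=
  PathOn.segment v hij (fun k _ _ => h.adj k) fun k l hk hkl hl => h.ne k l hkl (by omega)

lemma card_image (h : IsCyclicSeq G v n) {i j : ℕ} (hj : j < i + n) :
    ((Finset.Icc i j).image v).card = j + 1 - i := by
  rw [Finset.card_image_of_injOn, Nat.card_Icc]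
  intro a ha b hb hab
  simp only [Finset.coe_Icc, Set.mem_Icc] at ha hb
  by_contra hne
  rcases Nat.lt_or_gt_of_ne hne with h1 | h1
  · exact h.ne a b h1 (by omega) hab
  · exact h.ne b a h1 (by omega) hab.symm

lemma image_range_shift (h : IsCyclicSeq G v n) (a : ℕ) :
    (Finset.range n).image (fun i => v (a + i)) = (Finset.range n).image v := by
  have hn := h.three_le
  ext x
  simp only [Finset.mem_image, Finset.mem_range]
  constructor
  · rintro ⟨i, -, rfl⟩
    exact ⟨(a + i) % n, Nat.mod_lt _ (by omega), h.mod_eq _⟩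
  · rintro ⟨i, hi, rfl⟩
    refine ⟨(i + (n - a % n)) % n, Nat.mod_lt _ (by omega), ?_⟩
    rw [← h.mod_eq, ← h.mod_eq i]
    congr 1
    have := Nat.mod_lt a (show 0 < n by omega)
    rw [Nat.add_mod_mod, ← Nat.mod_add_mod, ← add_assoc]
    have : a % n + i + (n - a % n) = i + n := by omega
    rw [this]; simp

lemma disjoint_segments (h : IsCyclicSeq G v n) {i j k l : ℕ} (hjk : j < k) (hl : l < i + n) :
    Disjoint ((Finset.Icc i j).image v) ((Finset.Icc k l).image v) := by
  rw [Finset.disjoint_left]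
  intro x hx hx'
  obtain ⟨a, ha, rfl⟩ := Finset.mem_image.1 hx
  obtain ⟨b, hb, hab⟩ := Finset.mem_image.1 hx'
  rw [Finset.mem_Icc] at ha hb
  exact h.ne a b (by omega) (by omega) hab.symm

lemma mem_image_range (h : IsCyclicSeq G v n) (i : ℕ) : v i ∈ (Finset.range n).image v := by
  have := h.three_le
  rw [← h.mod_eq]
  exact Finset.mem_image_of_mem _ (Finset.mem_range.2 (Nat.mod_lt _ (by omega)))

lemma segment_subset (h : IsCyclicSeq G v n) (s : Finset ℕ) :
    s.image v ⊆ (Finset.range n).image v := by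
  intro x hx
  obtain ⟨a, -, rfl⟩ := Finset.mem_image.1 hx
  exact h.mem_image_range a

lemma card_image_range (h : IsCyclicSeq G v n) : ((Finset.range n).image v).card = n := by
  have hn := h.three_le
  have h2 := h.card_image (i := 0) (j := n - 1) (by omega)
  have h3 : Finset.Icc 0 (n - 1) = Finset.range n := by
    ext; simp only [Finset.mem_Icc, Finset.mem_range]; omega
  rw [h3] at h2
  omega

lemma cycleOn (h : IsCyclicSeq G v n) : CycleOn G ((Finset.range n).image v) := by
  have hn := h.three_le
  have h1 := h.segment (Nat.zero_le (n - 1)) (by omega)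
  have h2 := h.card_image (i := 0) (j := n - 1) (by omega)
  have h3 : Finset.Icc 0 (n - 1) = Finset.range n := by ext; simp; omega
  rw [h3] at h1 h2
  refine ⟨_, _, h1, ?_, by omega⟩
  have := h.adj (n - 1)
  have h4 := h.periodic 0
  rwa [show n - 1 + 1 = 0 + n by omega, h4] at this

end IsCyclicSeq

lemma CycleOn.exists_seq {s : Finset V} (h : CycleOn G s) :
    ∃ v, IsCyclicSeq G v s.card ∧ (Finset.range s.card).image v = s := by
  obtain ⟨a, b, hp, hadj, h3⟩ := h
  obtain ⟨w, h0, hl, ha, hi, hs⟩ := hp.exists_seq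
  refine ⟨fun i => w (i % s.card), ⟨h3, fun i => ?_, fun i => by simp, fun i j hij hj => ?_⟩, ?_⟩
  · have := Nat.mod_lt i (show 0 < s.card by omega)
    by_cases hi : i % s.card + 1 = s.card
    · have h1 : (i + 1) % s.card = 0 := by
        rw [← Nat.mod_add_mod, hi, Nat.mod_self]
      have h2 : i % s.card = s.card - 1 := by omega
      simpa [h1, h2, h0, hl] using hadj
    · have h1 : (i + 1) % s.card = i % s.card + 1 := by
        rw [← Nat.mod_add_mod, Nat.mod_eq_of_lt (by omega)]
      simpa [h1] using ha (i % s.card) (by omega)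
  · have h1 := Nat.mod_lt i (show 0 < s.card by omega)
    have h2 := Nat.mod_lt j (show 0 < s.card by omega)
    rcases lt_trichotomy (i % s.card) (j % s.card) with h | h | h
    · exact hi _ _ h h2
    · have := (Nat.modEq_iff_dvd' hij.le).1 h
      exact absurd (Nat.le_of_dvd (by omega) this) (by omega)
    · exact (hi _ _ h h1).symm
  · nth_rw 3 [← hs]
    exact Finset.image_congr fun i hi => by
      simp only [Finset.coe_range, Set.mem_Iio] at hi
      simp [Nat.mod_eq_of_lt hi]

/-- A cycle can be traversed starting from any of its vertices. -/
lemma CycleOn.exists_seq_from {s : Finset V} (h : CycleOn G s) {x : V} (hx : x ∈ s) :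
    ∃ v, IsCyclicSeq G v s.card ∧ (Finset.range s.card).image v = s ∧ v 0 = x := by
  obtain ⟨v, hv, hs⟩ := h.exists_seq
  rw [← hs] at hx
  obtain ⟨a, -, rfl⟩ := Finset.mem_image.1 hx
  exact ⟨_, hv.shift a, by rw [hv.image_range_shift a, hs], rfl⟩

lemma CycleOn.exists_isCycle {s : Finset V} (h : CycleOn G s) :
    ∃ (v : V) (w : G.Walk v v), w.IsCycle ∧ w.length = s.card := by
  obtain ⟨a, b, hp, hadj, h3⟩ := h
  obtain ⟨w, hw, hl, -⟩ := hp.exists_walk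
  refine ⟨b, .cons hadj w, ?_, by simp [hl]⟩
  rw [SimpleGraph.Walk.cons_isCycle_iff]
  refine ⟨hw, fun hmem => ?_⟩
  cases w with
  | nil => simp at hl; omega
  | @cons _ x _ hx q =>
    rw [SimpleGraph.Walk.cons_isPath_iff] at hw
    rw [SimpleGraph.Walk.edges_cons, List.mem_cons] at hmem
    rcases hmem with hmem | hmem
    · have hbx : b = x := by
        rcases Sym2.eq_iff.1 hmem with ⟨rfl, rfl⟩ | ⟨h, -⟩
        · exact absurd rfl hadj.ne
        · exact h
      subst hbx
      rw [SimpleGraph.Walk.isPath_iff_nil, ← SimpleGraph.Walk.length_eq_zero_iff] at hw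
      rw [SimpleGraph.Walk.length_cons, hw.1] at hl
      omega
    · exact hw.2 (q.snd_mem_support_of_mem_edges hmem)

end Paths

section Coloured

variable {V : Type*} [DecidableEq V] {G : SimpleGraph V} {col : V → Bool}

/-- The number of vertices of `s` with colour `b`. -/
def colourCount (col : V → Bool) (b : Bool) (s : Finset V) : ℕ := (s.filter (col · = b)).card

lemma colourCount_add (col : V → Bool) (b : Bool) (s : Finset V) :
    colourCount col b s + colourCount col (!b) s = s.card := by
  rw [← Finset.card_filter_add_card_filter_not (s := s) (fun v => col v = b)]
  unfold colourCount
  congr 2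
  ext v
  simp only [Finset.mem_filter]
  cases col v <;> cases b <;> simp

lemma colourCount_mono {s s' : Finset V} (h : s ⊆ s') (b : Bool) :
    colourCount col b s ≤ colourCount col b s' :=
  Finset.card_le_card (Finset.filter_subset_filter _ h)

lemma colourCount_insert {c : V} {s : Finset V} (hc : c ∉ s) (b : Bool) :
    colourCount col b (insert c s) = colourCount col b s + if col c = b then 1 else 0 := by
  unfold colourCount
  rw [Finset.filter_insert]
  split_ifs with h
  · rw [Finset.card_insert_of_notMem (by simp [hc])]
  · rfl

lemma colourCount_erase {c : V} {s : Finset V} (hc : c ∈ s) (b : Bool) :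
    colourCount col b (s.erase c) + (if col c = b then 1 else 0) = colourCount col b s := by
  rw [← colourCount_insert (Finset.notMem_erase c s), Finset.insert_erase hc]

lemma colourCount_union {s s' : Finset V} (h : Disjoint s s') (b : Bool) :
    colourCount col b (s ∪ s') = colourCount col b s + colourCount col b s' := by
  unfold colourCount
  rw [Finset.filter_union, Finset.card_union_of_disjoint]
  exact Finset.disjoint_filter_filter h

lemma colourCount_sdiff {s s' : Finset V} (h : s' ⊆ s) (b : Bool) :
    colourCount col b (s \ s') + colourCount col b s' = colourCount col b s := by
  rw [← colourCount_union Finset.sdiff_disjoint, Finset.sdiff_union_of_subset h]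

lemma PathOn.colourCount_eq (hcol : ∀ u v, G.Adj u v → col u ≠ col v) {a b : V} {s : Finset V}
    (h : PathOn G a b s) :
    colourCount col (col a) s = colourCount col (!col a) s + if col a = col b then 1 else 0 := by
  induction h with
  | single a => simp [colourCount, Finset.filter_singleton]
  | @cons c a b s hadj hn h1 ih =>
    rw [colourCount_insert hn, colourCount_insert hn]
    have := hcol _ _ hadj
    cases hc : col c <;> cases ha : col a <;> cases hb : col b <;> simp_all

lemma PathOn.two_mul_colourCount (hcol : ∀ u v, G.Adj u v → col u ≠ col v) {a b : V}
    {s : Finset V} (h : PathOn G a b s) (hab : col a ≠ col b) (d : Bool) :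
    2 * colourCount col d s = s.card := by
  have h1 := h.colourCount_eq hcol
  rw [if_neg hab, add_zero] at h1
  have h2 := colourCount_add col d s
  have h3 : colourCount col d s = colourCount col (!d) s := by
    cases d <;> cases hx : col a <;> simp_all
  omega

lemma CycleOn.colourCount_eq (hcol : ∀ u v, G.Adj u v → col u ≠ col v) {s : Finset V}
    (h : CycleOn G s) (b : Bool) : 2 * colourCount col b s = s.card :=
  let ⟨_, _, hp, hadj, _⟩ := h
  hp.two_mul_colourCount hcol (hcol _ _ hadj).symm b

lemma IsCyclicSeq.col_eq_iff (hcol : ∀ u v, G.Adj u v → col u ≠ col v) {v : ℕ → V} {n : ℕ}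
    (h : IsCyclicSeq G v n) (i j : ℕ) : col (v i) = col (v j) ↔ i % 2 = j % 2 := by
  have key : ∀ i, col (v i) = xor (col (v 0)) (decide (i % 2 = 1)) := by
    intro i
    induction i with
    | zero => simp
    | succ i ih =>
      have h1 := hcol _ _ (h.adj i)
      rcases Nat.mod_two_eq_zero_or_one i with h2 | h2
      · have h3 : (i + 1) % 2 = 1 := by omega
        cases h4 : col (v 0) <;> cases h5 : col (v i) <;> cases h6 : col (v (i + 1)) <;> simp_all
      · have h3 : (i + 1) % 2 = 0 := by omega
        cases h4 : col (v 0) <;> cases h5 : col (v i) <;> cases h6 : col (v (i + 1)) <;> simp_all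
  rw [key i, key j]
  rcases Nat.mod_two_eq_zero_or_one i with h2 | h2 <;>
    rcases Nat.mod_two_eq_zero_or_one j with h3 | h3 <;> simp [h2, h3]

lemma IsCyclicSeq.even (hcol : ∀ u v, G.Adj u v → col u ≠ col v) {v : ℕ → V} {n : ℕ}
    (h : IsCyclicSeq G v n) : n % 2 = 0 := by
  have h1 := (h.col_eq_iff hcol (0 + n) 0).1 (congrArg col (h.periodic 0))
  omega

/-- Adjacent vertices of a cycle occupy positions of different parity. -/
lemma IsCyclicSeq.parity_ne (hcol : ∀ u v, G.Adj u v → col u ≠ col v) {v : ℕ → V} {n : ℕ}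
    (h : IsCyclicSeq G v n) {i j : ℕ} (hij : G.Adj (v i) (v j)) : i % 2 ≠ j % 2 :=
  fun h' => hcol _ _ hij ((h.col_eq_iff hcol i j).2 h')

end Coloured

section Degrees

variable {V : Type*} [DecidableEq V] (G : SimpleGraph V) [DecidableRel G.Adj]

/-- The number of neighbours of `v` in `S`. -/
def degreeIn (S : Finset V) (v : V) : ℕ := (S.filter (G.Adj v)).card

/-- The degree sum of the subgraph induced on `S`, i.e. twice its number of edges. -/
def degreeSum (S : Finset V) : ℕ := ∑ v ∈ S, degreeIn G S v

/-- `G` has a cycle of length `k` inside `S`. -/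
def HasCycle (S : Finset V) (k : ℕ) : Prop := ∃ s ⊆ S, CycleOn G s ∧ s.card = k

variable {G}

lemma HasCycle.mono {S S' : Finset V} (h : S ⊆ S') {k : ℕ} : HasCycle G S k → HasCycle G S' k :=
  fun ⟨s, hs, hc⟩ => ⟨s, hs.trans h, hc⟩

lemma degreeIn_union {S S' : Finset V} (h : Disjoint S S') (v : V) :
    degreeIn G (S ∪ S') v = degreeIn G S v + degreeIn G S' v := by
  unfold degreeIn
  rw [Finset.filter_union, Finset.card_union_of_disjoint]
  exact Finset.disjoint_filter_filter h

lemma degreeIn_sdiff {S S' : Finset V} (h : S' ⊆ S) (v : V) :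
    degreeIn G (S \ S') v + degreeIn G S' v = degreeIn G S v := by
  rw [← degreeIn_union Finset.sdiff_disjoint, Finset.sdiff_union_of_subset h]

lemma degreeIn_singleton (u v : V) : degreeIn G {u} v = if G.Adj v u then 1 else 0 := by
  unfold degreeIn
  rw [Finset.filter_singleton]
  split_ifs <;> simp

lemma degreeIn_erase {S : Finset V} {u : V} (hu : u ∈ S) (v : V) :
    degreeIn G (S.erase u) v + (if G.Adj v u then 1 else 0) = degreeIn G S v := by
  rw [← degreeIn_singleton, Finset.erase_eq, degreeIn_sdiff (by simpa using hu)]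

lemma degreeIn_erase_self (S : Finset V) (v : V) : degreeIn G (S.erase v) v = degreeIn G S v := by
  unfold degreeIn
  congr 1
  ext u
  simp only [Finset.mem_filter, Finset.mem_erase]
  constructor
  · rintro ⟨⟨_, h⟩, h'⟩; exact ⟨h, h'⟩
  · rintro ⟨h, h'⟩; exact ⟨⟨h'.ne.symm, h⟩, h'⟩

lemma degreeSum_erase {S : Finset V} {v : V} (hv : v ∈ S) :
    degreeSum G (S.erase v) + 2 * degreeIn G S v = degreeSum G S := by
  have h1 : degreeSum G S = degreeIn G S v + ∑ u ∈ S.erase v, degreeIn G S u :=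
    (Finset.add_sum_erase _ _ hv).symm
  have h2 : ∑ u ∈ S.erase v, degreeIn G S u =
      degreeSum G (S.erase v) + ∑ u ∈ S.erase v, (if G.Adj u v then 1 else 0) := by
    rw [degreeSum, ← Finset.sum_add_distrib]
    exact Finset.sum_congr rfl fun u _ => (degreeIn_erase hv u).symm
  have h3 : ∑ u ∈ S.erase v, (if G.Adj u v then 1 else 0) = degreeIn G S v := by
    rw [← degreeIn_erase_self, degreeIn, Finset.card_filter]
    simp only [G.adj_comm]
  omega

lemma degreeSum_erase_erase {S : Finset V} {u v : V} (hu : u ∈ S) (hv : v ∈ S) (huv : u ≠ v) :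
    degreeSum G ((S.erase u).erase v) + 2 * (degreeIn G S u + degreeIn G S v) =
      degreeSum G S + 2 * (if G.Adj v u then 1 else 0) := by
  have h1 := degreeSum_erase (G := G) hu
  have h2 := degreeSum_erase (G := G) (S := S.erase u) (v := v) (Finset.mem_erase.2 ⟨huv.symm, hv⟩)
  have h3 := degreeIn_erase (G := G) hu v
  omega

/-- Vertex sets without edges between them contribute additively to the degree sum. -/
lemma degreeSum_union {S S' : Finset V} (h : Disjoint S S')
    (hno : ∀ u ∈ S, ∀ v ∈ S', ¬ G.Adj u v) :
    degreeSum G (S ∪ S') = degreeSum G S + degreeSum G S' := by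
  unfold degreeSum
  rw [Finset.sum_union h]
  congr 1 <;> refine Finset.sum_congr rfl fun u hu => ?_ <;> rw [degreeIn_union h]
  · have : degreeIn G S' u = 0 := by
      rw [degreeIn, Finset.card_eq_zero, Finset.filter_eq_empty_iff]
      exact fun v hv => hno u hu v hv
    omega
  · have : degreeIn G S u = 0 := by
      rw [degreeIn, Finset.card_eq_zero, Finset.filter_eq_empty_iff]
      exact fun v hv h' => hno v hv u hu h'.symm
    omega

variable {col : V → Bool}

lemma degreeIn_le_colourCount (hcol : ∀ u v, G.Adj u v → col u ≠ col v) (S : Finset V) (v : V) :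
    degreeIn G S v ≤ colourCount col (!col v) S := by
  refine Finset.card_le_card fun u hu => ?_
  rw [Finset.mem_filter] at hu ⊢
  have := hcol _ _ hu.2
  exact ⟨hu.1, by cases h : col u <;> cases h' : col v <;> simp_all⟩

lemma degreeSum_eq_two_mul (hcol : ∀ u v, G.Adj u v → col u ≠ col v) (S : Finset V) (b : Bool) :
    degreeSum G S = 2 * ∑ v ∈ S.filter (col · = b), degreeIn G S v := by
  have h1 : degreeSum G S = ∑ v ∈ S.filter (col · = b), degreeIn G S v +
      ∑ v ∈ S.filter (¬ col · = b), degreeIn G S v :=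
    (Finset.sum_filter_add_sum_filter_not _ _ _).symm
  have key : ∀ c : Bool, ∀ v ∈ S.filter (col · = c),
      degreeIn G S v = ((S.filter (¬ col · = c)).filter (G.Adj v)).card := by
    intro c v hv
    rw [degreeIn]
    congr 1
    ext u
    simp only [Finset.mem_filter] at hv ⊢
    refine ⟨fun h => ⟨⟨h.1, fun h' => hcol _ _ h.2 (by rw [hv.2, h'])⟩, h.2⟩, fun h => ⟨h.1.1, h.2⟩⟩
  have h2 := Finset.sum_card_bipartiteAbove_eq_sum_card_bipartiteBelow
    (s := S.filter (col · = b)) (t := S.filter (¬ col · = b)) (r := G.Adj)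
  rw [two_mul, h1]
  congr 1
  rw [Finset.sum_congr rfl (key b)]
  unfold Finset.bipartiteAbove Finset.bipartiteBelow at h2
  rw [h2]
  refine Finset.sum_congr rfl fun v hv => ?_
  rw [degreeIn]
  congr 1
  ext u
  simp only [Finset.mem_filter] at hv ⊢
  refine ⟨fun h => ⟨⟨h.1, ?_⟩, h.2.symm⟩, fun h => ⟨h.1.1, h.2.symm⟩⟩
  have := hcol _ _ h.2
  cases h : col u <;> cases h' : col v <;> cases b <;> simp_all

lemma degreeSum_le_mul (hcol : ∀ u v, G.Adj u v → col u ≠ col v) (S : Finset V) (b : Bool) :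
    degreeSum G S ≤ 2 * (colourCount col b S * colourCount col (!b) S) := by
  rw [degreeSum_eq_two_mul hcol S b]
  refine Nat.mul_le_mul_left _ ?_
  rw [colourCount, ← smul_eq_mul]
  refine Finset.sum_le_card_nsmul _ _ _ fun v hv => ?_
  rw [Finset.mem_filter] at hv
  rw [← hv.2]
  exact degreeIn_le_colourCount hcol S v

end Degrees

section Hamiltonian

variable {V : Type*} [DecidableEq V] {G : SimpleGraph V} [DecidableRel G.Adj] {col : V → Bool}

/-- The degree of a vertex into a cycle, counted through positions on the cycle. -/
lemma IsCyclicSeq.degreeIn_eq {v : ℕ → V} {n : ℕ} (h : IsCyclicSeq G v n) (a : ℕ) (x : V) :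
    degreeIn G ((Finset.range n).image v) x =
      ((Finset.Ico a (a + n)).filter fun i => G.Adj x (v i)).card := by
  rw [← h.image_range_shift a, degreeIn, Finset.filter_image, Finset.card_image_of_injOn]
  · rw [Finset.range_eq_Ico]
    have := Finset.card_map (addLeftEmbedding a)
      (s := (Finset.Ico 0 n).filter fun i => G.Adj x (v (a + i)))
    rw [← this]
    congr 1
    ext k
    simp only [Finset.mem_map, Finset.mem_filter, Finset.mem_Ico, addLeftEmbedding_apply]
    constructor
    · rintro ⟨i, ⟨h1, h2⟩, rfl⟩
      exact ⟨by omega, h2⟩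
    · rintro ⟨h1, h2⟩
      exact ⟨k - a, ⟨by omega, by rwa [Nat.add_sub_cancel' h1.1]⟩, by omega⟩
  · intro i hi j hj hij
    simp only [Finset.coe_filter, Finset.mem_range, Set.mem_ofPred_eq] at hi hj
    by_contra hne
    rcases Nat.lt_or_gt_of_ne hne with h1 | h1
    · exact h.ne (a + i) (a + j) (by omega) (by omega) hij
    · exact h.ne (a + j) (a + i) (by omega) (by omega) hij.symm

lemma IsCyclicSeq.sum_image {v : ℕ → V} {n : ℕ} (h : IsCyclicSeq G v n) (f : V → ℕ) :
    ∑ x ∈ (Finset.range n).image v, f x = ∑ i ∈ Finset.range n, f (v i) := by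
  refine Finset.sum_image fun i hi j hj hij => ?_
  simp only [Finset.coe_range, Set.mem_Iio] at hi hj
  by_contra hne
  rcases Nat.lt_or_gt_of_ne hne with h1 | h1
  · exact h.ne i j h1 (by omega) hij
  · exact h.ne j i h1 (by omega) hij.symm

/-- Two consecutive vertices of a Hamiltonian cycle with large degree sum produce shorter
cycles. -/
lemma IsCyclicSeq.hasCycle_of_degree (hcol : ∀ u v, G.Adj u v → col u ≠ col v) {w : ℕ → V}
    {c t : ℕ} (h : IsCyclicSeq G w (2 * c)) (ht : 2 ≤ t) (htc : t ≤ c)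
    (hdeg : c + 2 ≤ degreeIn G ((Finset.range (2 * c)).image w) (w 0) +
      degreeIn G ((Finset.range (2 * c)).image w) (w 1)) :
    HasCycle G ((Finset.range (2 * c)).image w) (2 * t) := by
  have h0 : w (2 * c) = w 0 := by simpa using h.periodic 0
  set A := (Finset.Icc 3 (2 * c - 1)).filter fun k => G.Adj (w 0) (w k) with hA
  set B := (Finset.Icc 2 (2 * c - 2)).filter fun k => G.Adj (w 1) (w k) with hB
  set φ : ℕ → ℕ := fun k => if k ≤ 2 * t - 3 then k + (2 * c + 1 - 2 * t) else k - (2 * t - 3) with hφ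
  have hAo : ∀ k ∈ A, k % 2 = 1 := fun k hk => by
    have := h.parity_ne hcol (Finset.mem_filter.1 hk).2
    omega
  have hBe : ∀ k ∈ B, k % 2 = 0 := fun k hk => by
    have := h.parity_ne hcol (Finset.mem_filter.1 hk).2
    omega
  have hAc : degreeIn G ((Finset.range (2 * c)).image w) (w 0) ≤ A.card + 1 := by
    rw [h.degreeIn_eq 0]
    refine (Finset.card_le_card fun k hk => ?_).trans (Finset.card_insert_le 1 A)
    simp only [Finset.mem_filter, Finset.mem_Ico, hA, Finset.mem_insert, Finset.mem_Icc] at hk ⊢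
    have := h.parity_ne hcol hk.2
    by_cases h1 : k = 1
    · exact Or.inl h1
    · exact Or.inr ⟨by omega, hk.2⟩
  have hBc : degreeIn G ((Finset.range (2 * c)).image w) (w 1) ≤ B.card + 1 := by
    rw [h.degreeIn_eq 0]
    refine (Finset.card_le_card fun k hk => ?_).trans (Finset.card_insert_le 0 B)
    simp only [Finset.mem_filter, Finset.mem_Ico, hB, Finset.mem_insert, Finset.mem_Icc] at hk ⊢
    have := h.parity_ne hcol hk.2
    by_cases h1 : k = 0
    · exact Or.inl h1
    · exact Or.inr ⟨by omega, hk.2⟩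
  have hφA : (A.image φ).card = A.card := by
    refine Finset.card_image_of_injOn fun i hi j hj hij => ?_
    have h1 := Finset.mem_Icc.1 (Finset.mem_filter.1 hi).1
    have h2 := Finset.mem_Icc.1 (Finset.mem_filter.1 hj).1
    have h3 := hAo i hi
    have h4 := hAo j hj
    simp only [hφ] at hij
    split_ifs at hij <;> omega
  have hsub : A.image φ ∪ B ⊆ (Finset.Icc 1 (c - 1)).image (2 * ·) := by
    intro k hk
    rw [Finset.mem_image]
    have hk' : k % 2 = 0 ∧ 2 ≤ k ∧ k ≤ 2 * c - 2 := by
      rcases Finset.mem_union.1 hk with hk | hk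
      · obtain ⟨i, hi, rfl⟩ := Finset.mem_image.1 hk
        have h1 := Finset.mem_Icc.1 (Finset.mem_filter.1 hi).1
        have h3 := hAo i hi
        simp only [hφ]
        split_ifs <;> omega
      · have h1 := Finset.mem_Icc.1 (Finset.mem_filter.1 hk).1
        exact ⟨hBe k hk, h1⟩
    exact ⟨k / 2, Finset.mem_Icc.2 (by omega), by omega⟩
  have hcard := (Finset.card_le_card hsub).trans Finset.card_image_le
  rw [Nat.card_Icc] at hcard
  have hinter := Finset.card_union_add_card_inter (A.image φ) B
  obtain ⟨y, hy⟩ : (A.image φ ∩ B).Nonempty := Finset.card_pos.1 (by omega)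
  rw [Finset.mem_inter, Finset.mem_image] at hy
  obtain ⟨⟨k, hkA, rfl⟩, hkB⟩ := hy
  obtain ⟨hk1, hk2⟩ := Finset.mem_filter.1 hkA
  obtain ⟨hk3, hk4⟩ := Finset.mem_filter.1 hkB
  rw [Finset.mem_Icc] at hk1 hk3
  by_cases hk : k ≤ 2 * t - 3
  · have hφk : φ k = k + (2 * c + 1 - 2 * t) := by simp [hφ, hk]
    rw [hφk] at hk3 hk4
    have p1 := h.segment (i := 1) (j := k) (by omega) (by omega)
    have p2 := (h.segment (i := k + (2 * c + 1 - 2 * t)) (j := 2 * c) (by omega) (by omega)).symm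
    have c1 := h.card_image (i := 1) (j := k) (by omega)
    have c2 := h.card_image (i := k + (2 * c + 1 - 2 * t)) (j := 2 * c) (by omega)
    have hd := h.disjoint_segments (i := 1) (j := k) (k := k + (2 * c + 1 - 2 * t))
      (l := 2 * c) (by omega) (by omega)
    refine ⟨_, ?_, p1.close p2 (by rw [h0]; exact hk2.symm) hk4.symm hd (by omega), ?_⟩
    · exact Finset.union_subset (h.segment_subset _) (h.segment_subset _)
    · rw [Finset.card_union_of_disjoint hd]; omega
  · have hφk : φ k = k - (2 * t - 3) := by simp [hφ, hk]
    rw [hφk] at hk3 hk4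
    have p1 := h.segment (i := 0) (j := 1) (by omega) (by omega)
    have p2 := h.segment (i := k - (2 * t - 3)) (j := k) (by omega) (by omega)
    have c1 := h.card_image (i := 0) (j := 1) (by omega)
    have c2 := h.card_image (i := k - (2 * t - 3)) (j := k) (by omega)
    have hd := h.disjoint_segments (i := 0) (j := 1) (k := k - (2 * t - 3))
      (l := k) (by omega) (by omega)
    refine ⟨_, ?_, p1.close p2 hk4 hk2.symm hd (by omega), ?_⟩
    · exact Finset.union_subset (h.segment_subset _) (h.segment_subset _)
    · rw [Finset.card_union_of_disjoint hd]; omega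

/-- A dense balanced bipartite graph with a Hamiltonian cycle has cycles of all prescribed
lengths. -/
lemma CycleOn.hasCycle_of_degreeSum (hcol : ∀ u v, G.Adj u v → col u ≠ col v) {S : Finset V}
    {c t : ℕ} (h : CycleOn G S) (hS : S.card = 2 * c) (ht : 2 ≤ t) (htc : t ≤ c)
    (he : c * (c + 1) < degreeSum G S) : HasCycle G S (2 * t) := by
  obtain ⟨v, hv, hvS⟩ := h.exists_seq
  rw [hS] at hv hvS
  obtain ⟨i, hi⟩ : ∃ i, c + 2 ≤ degreeIn G S (v i) + degreeIn G S (v (i + 1)) := by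
    by_contra! hcon
    have h1 : degreeSum G S = ∑ i ∈ Finset.range (2 * c), degreeIn G S (v i) := by
      rw [degreeSum]
      nth_rw 1 [← hvS]
      exact hv.sum_image _
    have h2 : degreeSum G S = ∑ i ∈ Finset.range (2 * c), degreeIn G S (v (i + 1)) := by
      rw [degreeSum]
      have h4 := (hv.shift 1).sum_image (degreeIn G S)
      rw [hv.image_range_shift 1, hvS] at h4
      rw [h4]
      simp only [add_comm]
    have h3 : ∑ i ∈ Finset.range (2 * c), (degreeIn G S (v i) + degreeIn G S (v (i + 1))) ≤
        (Finset.range (2 * c)).card • (c + 1) :=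
      Finset.sum_le_card_nsmul _ _ _ fun i _ => by have := hcon i; omega
    rw [Finset.sum_add_distrib, ← h1, ← h2, Finset.card_range, smul_eq_mul] at h3
    nlinarith
  have hw := hv.shift i
  have hwS := hv.image_range_shift i
  rw [hvS] at hwS
  have := hw.hasCycle_of_degree hcol ht htc (by rw [hwS]; exact hi)
  rwa [hwS] at this

end Hamiltonian

section Longest

variable {V : Type*} [DecidableEq V] {G : SimpleGraph V} [DecidableRel G.Adj] {col : V → Bool}

/-- `v` runs periodically around a longest cycle of the subgraph induced on `S`. -/
structure IsLongestSeq (G : SimpleGraph V) (S : Finset V) (v : ℕ → V) (n : ℕ) : Prop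
    extends IsCyclicSeq G v n where
  mem : ∀ i, v i ∈ S
  card_le : ∀ s ⊆ S, CycleOn G s → s.card ≤ n

lemma card_le_of_parity {s : Finset ℕ} {c a : ℕ} (hs : s ⊆ Finset.Ico a (a + 2 * c))
    (hp : ∀ i ∈ s, ∀ j ∈ s, i % 2 = j % 2) : s.card ≤ c := by
  have h : (s.image fun i => (i - a) / 2).card = s.card := by
    refine Finset.card_image_of_injOn fun i hi j hj hij => ?_
    have h1 := hp i hi j hj
    have h2 := Finset.mem_Ico.1 (hs hi)
    have h3 := Finset.mem_Ico.1 (hs hj)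
    omega
  have h2 : (s.image fun i => (i - a) / 2) ⊆ Finset.range c := by
    intro k hk
    obtain ⟨i, hi, rfl⟩ := Finset.mem_image.1 hk
    have h2 := Finset.mem_Ico.1 (hs hi)
    rw [Finset.mem_range]
    omega
  simpa [h] using Finset.card_le_card h2

namespace IsLongestSeq

variable {S P : Finset V} {v : ℕ → V} {n c i j k r : ℕ} {x y : V}

lemma shift_longest (h : IsLongestSeq G S v n) (a : ℕ) :
    IsLongestSeq G S (fun i => v (a + i)) n where
  toIsCyclicSeq := h.toIsCyclicSeq.shift a
  mem _ := h.mem _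
  card_le := h.card_le

lemma image_subset (h : IsLongestSeq G S v n) (s : Finset ℕ) : s.image v ⊆ S := by
  intro _ hx
  obtain ⟨a, -, rfl⟩ := Finset.mem_image.1 hx
  exact h.mem a

/-- The feet of a path outside a longest cycle are far apart. -/
lemma gap (h : IsLongestSeq G S v n) (hP : PathOn G x y P) (hPS : P ⊆ S)
    (hd : Disjoint P ((Finset.range n).image v)) (hx : G.Adj x (v i)) (hy : G.Adj y (v j))
    (hij : i < j) (hj : j < i + n) : P.card + 1 ≤ j - i := by
  have p1 := h.segment (i := j) (j := i + n) hj.le (by omega)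
  have c1 := h.card_image (i := j) (j := i + n) (by omega)
  have hP0 : 0 < P.card := Finset.card_pos.2 ⟨_, hP.left_mem⟩
  have hd' : Disjoint ((Finset.Icc j (i + n)).image v) P :=
    (hd.mono_right (h.segment_subset _)).symm
  have hc := p1.close hP (by rw [h.periodic]; exact hx.symm) hy hd' (by omega)
  have := h.card_le _ (Finset.union_subset (h.image_subset _) hPS) hc
  rw [Finset.card_union_of_disjoint hd'] at this
  omega

lemma degreeIn_add_le (h : IsLongestSeq G S v (2 * c)) (hcol : ∀ u v, G.Adj u v → col u ≠ col v)
    (hx : x ∈ S) (hy : y ∈ S) (hx' : x ∉ (Finset.range (2 * c)).image v)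
    (hy' : y ∉ (Finset.range (2 * c)).image v) (hxy : col x ≠ col y) :
    degreeIn G ((Finset.range (2 * c)).image v) x +
      degreeIn G ((Finset.range (2 * c)).image v) y ≤ c + 1 := by
  by_contra! hcon
  set A := (Finset.Ico 0 (0 + 2 * c)).filter fun i => G.Adj x (v i) with hA
  set B := (Finset.Ico 0 (0 + 2 * c)).filter fun i => G.Adj y (v (1 + i)) with hB
  have hA' : _ = A.card := h.degreeIn_eq 0 x
  have hB' : _ = B.card := (h.toIsCyclicSeq.shift 1).degreeIn_eq 0 y
  rw [h.image_range_shift 1] at hB'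
  have hcard : (A ∪ B).card ≤ c := by
    refine card_le_of_parity (a := 0) (Finset.union_subset (Finset.filter_subset _ _)
      (Finset.filter_subset _ _)) fun i hi j hj => ?_
    have key : ∀ i ∈ A ∪ B, col (v i) = col y := by
      intro i hi
      rcases Finset.mem_union.1 hi with hi | hi
      · have := hcol _ _ (Finset.mem_filter.1 hi).2
        cases h1 : col x <;> cases h2 : col y <;> cases h3 : col (v i) <;> simp_all
      · have h1 := hcol _ _ (Finset.mem_filter.1 hi).2
        have h2 := hcol _ _ (h.adj i)
        rw [add_comm] at h2
        cases h1 : col (v (1 + i)) <;> cases h2 : col y <;> cases h3 : col (v i) <;> simp_all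
    rw [← h.col_eq_iff hcol, key i hi, key j hj]
  have hinter := Finset.card_union_add_card_inter A B
  obtain ⟨i, hi, j, hj, hne⟩ := Finset.one_lt_card.1 (show 1 < (A ∩ B).card by omega)
  wlog hij : i < j generalizing i j
  · exact this j hj i hi hne.symm (by omega)
  simp only [hA, hB, Finset.mem_inter, Finset.mem_filter, Finset.mem_Ico] at hi hj
  have hn := h.three_le
  have p1 := (h.segment (i := 1 + i) (j := j) (by omega) (by omega)).symm
  have c1 := h.card_image (i := 1 + i) (j := j) (by omega)
  have hxn : x ∉ (Finset.Icc (1 + i) j).image v := fun hm => hx' (h.segment_subset _ hm)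
  have p2 := PathOn.cons hj.1.2 hxn p1
  have hyn : y ∉ insert x ((Finset.Icc (1 + i) j).image v) := by
    rw [Finset.mem_insert]
    rintro (rfl | hm)
    · exact hxy rfl
    · exact hy' (h.segment_subset _ hm)
  have p3 := p2.snoc hi.2.2.symm hyn
  have p4 := h.segment (i := 1 + j) (j := i + 2 * c) (by omega) (by omega)
  have c4 := h.card_image (i := 1 + j) (j := i + 2 * c) (by omega)
  have hd : Disjoint (insert y (insert x ((Finset.Icc (1 + i) j).image v)))
      ((Finset.Icc (1 + j) (i + 2 * c)).image v) := by
    rw [Finset.disjoint_insert_left, Finset.disjoint_insert_left]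
    exact ⟨fun hm => hy' (h.segment_subset _ hm), fun hm => hx' (h.segment_subset _ hm),
      h.disjoint_segments (by omega) (by omega)⟩
  have c5 : (insert y (insert x ((Finset.Icc (1 + i) j).image v))).card = j - i + 2 := by
    rw [Finset.card_insert_of_notMem hyn, Finset.card_insert_of_notMem hxn]
    omega
  have hc := p3.close p4 hj.2.2 (by rw [h.periodic]; exact hi.1.2.symm) hd (by omega)
  have := h.card_le _ (Finset.union_subset (Finset.insert_subset hy (Finset.insert_subset hx
    (h.image_subset _))) (h.image_subset _)) hc
  rw [Finset.card_union_of_disjoint hd] at this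
  omega

lemma degreeIn_add_le_of_path_aux (h : IsLongestSeq G S v (2 * c))
    (hcol : ∀ u v, G.Adj u v → col u ≠ col v) (hP : PathOn G x y P) (hPS : P ⊆ S)
    (hd : Disjoint P ((Finset.range (2 * c)).image v)) (hk : P.card = 2 * k)
    (hxy : col x ≠ col y) {f : ℕ} (hy0 : G.Adj y (v 0)) (hxf : G.Adj x (v f)) (hf0 : 0 < f)
    (hfn : f < 2 * c) (hxn : ∀ i, 0 < i → i < f → ¬ G.Adj x (v i))
    (hyn : ∀ i, 0 < i → i < f → ¬ G.Adj y (v i)) :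
    degreeIn G ((Finset.range (2 * c)).image v) x +
      degreeIn G ((Finset.range (2 * c)).image v) y + k ≤ c + 1 := by
  have hfk := h.gap hP.symm (hPS) hd hy0 hxf hf0 (by omega)
  have hyp : ∀ i, G.Adj y (v i) → i % 2 = 0 := fun i hi => by
    have h1 := hcol _ _ hi
    have h2 := hcol _ _ hy0
    have := (h.col_eq_iff hcol i 0).1 (by
      cases h3 : col y <;> cases h4 : col (v i) <;> cases h5 : col (v 0) <;> simp_all)
    omega
  have hxp : ∀ i, G.Adj x (v i) → i % 2 = 1 := fun i hi => by
    have h1 := hcol _ _ hi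
    have h2 := hcol _ _ hy0
    have := (h.col_eq_iff hcol i 0).not.1 (by
      cases h3 : col y <;> cases h6 : col x <;> cases h4 : col (v i) <;>
        cases h5 : col (v 0) <;> simp_all)
    omega
  set A := (Finset.Ico 0 (0 + 2 * c)).filter fun i => G.Adj x (v i) with hA
  set B := (Finset.Ico 0 (0 + 2 * c)).filter fun i => G.Adj y (v i) with hB
  set D := (Finset.Ico 1 k).image fun i => 2 * i + 1 with hD
  have hBc : (B.image (· + 1)).card = B.card :=
    Finset.card_image_of_injective _ (add_left_injective 1)
  have hDc : D.card = k - 1 := by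
    rw [hD, Finset.card_image_of_injective _ (fun a b hab => by simpa using hab), Nat.card_Ico]
  have h1 : Disjoint A (B.image (· + 1)) := by
    rw [Finset.disjoint_left]
    intro i hi hi'
    obtain ⟨l, hl, rfl⟩ := Finset.mem_image.1 hi'
    have hP0 : 0 < P.card := Finset.card_pos.2 ⟨_, hP.left_mem⟩
    have := h.gap hP.symm hPS hd (Finset.mem_filter.1 hl).2 (Finset.mem_filter.1 hi).2
      (by omega) (by have := h.three_le; omega)
    omega
  have h2 : Disjoint (A ∪ B.image (· + 1)) D := by
    rw [Finset.disjoint_left]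
    intro i hi hi'
    obtain ⟨l, hl, rfl⟩ := Finset.mem_image.1 hi'
    rw [Finset.mem_Ico] at hl
    rcases Finset.mem_union.1 hi with hi | hi
    · exact hxn _ (by omega) (by omega) (Finset.mem_filter.1 hi).2
    · obtain ⟨l', hl', h3⟩ := Finset.mem_image.1 hi
      exact hyn l' (by omega) (by omega) (Finset.mem_filter.1 hl').2
  have h3 : (A ∪ B.image (· + 1) ∪ D).card ≤ c := by
    have hodd : ∀ i ∈ A ∪ B.image (· + 1) ∪ D, i % 2 = 1 ∧ i < 2 * c := by
      intro i hi
      rw [Finset.mem_union, Finset.mem_union] at hi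
      rcases hi with (hi | hi) | hi
      · have h1 := Finset.mem_filter.1 hi
        have h2 := Finset.mem_Ico.1 h1.1
        exact ⟨hxp i h1.2, by omega⟩
      · obtain ⟨l', hl', rfl⟩ := Finset.mem_image.1 hi
        have h1 := Finset.mem_filter.1 hl'
        have h2 := Finset.mem_Ico.1 h1.1
        have h3 := hyp _ h1.2
        omega
      · obtain ⟨l, hl, rfl⟩ := Finset.mem_image.1 hi
        rw [Finset.mem_Ico] at hl
        omega
    refine card_le_of_parity (a := 0) (fun i hi => ?_) fun i hi j hj => ?_
    · have := hodd i hi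
      rw [Finset.mem_Ico]
      omega
    · rw [(hodd i hi).1, (hodd j hj).1]
  rw [Finset.card_union_of_disjoint h2, Finset.card_union_of_disjoint h1, hBc, hDc] at h3
  have hA' : _ = A.card := h.degreeIn_eq 0 x
  have hB' : _ = B.card := h.degreeIn_eq 0 y
  have hP0 : 0 < P.card := Finset.card_pos.2 ⟨_, hP.left_mem⟩
  omega

lemma exists_adj_of_degreeIn_pos (h : IsCyclicSeq G v n)
    (hx : 0 < degreeIn G ((Finset.range n).image v) x) (a : ℕ) :
    ∃ i, a ≤ i ∧ i < a + n ∧ G.Adj x (v i) := by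
  rw [h.degreeIn_eq a, Finset.card_pos] at hx
  obtain ⟨i, hi⟩ := hx
  rw [Finset.mem_filter, Finset.mem_Ico] at hi
  exact ⟨i, hi.1.1, hi.1.2, hi.2⟩

/-- If both ends of an outside path of `2k` vertices attach to a longest cycle, then their degrees
into the cycle are small. -/
lemma degreeIn_add_le_of_path (h : IsLongestSeq G S v (2 * c))
    (hcol : ∀ u v, G.Adj u v → col u ≠ col v) (hP : PathOn G x y P) (hPS : P ⊆ S)
    (hd : Disjoint P ((Finset.range (2 * c)).image v)) (hk : P.card = 2 * k)
    (hxy : col x ≠ col y) (hx : 0 < degreeIn G ((Finset.range (2 * c)).image v) x)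
    (hy : 0 < degreeIn G ((Finset.range (2 * c)).image v) y) :
    degreeIn G ((Finset.range (2 * c)).image v) x +
      degreeIn G ((Finset.range (2 * c)).image v) y + k ≤ c + 1 := by
  classical
  obtain ⟨a, -, -, ha⟩ := exists_adj_of_degreeIn_pos h.toIsCyclicSeq hy 0
  have hex := exists_adj_of_degreeIn_pos h.toIsCyclicSeq hx a
  obtain ⟨hf1, hf2, hf3⟩ := Nat.find_spec hex
  have hfmin : ∀ i, a ≤ i → i < Nat.find hex → ¬ G.Adj x (v i) := fun i hi hi' hadj =>
    Nat.find_min hex hi' ⟨hi, by omega, hadj⟩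
  set f := Nat.find hex
  have haf : a ≠ f := by
    intro h1
    have h2 := hcol _ _ ha
    have h3 := hcol _ _ hf3
    rw [← h1] at h3
    cases h4 : col x <;> cases h5 : col y <;> cases h6 : col (v a) <;> simp_all
  obtain ⟨g, hg, hgmax⟩ := Finset.exists_max_image
    ((Finset.Ico a f).filter fun i => G.Adj y (v i)) id
    ⟨a, by rw [Finset.mem_filter, Finset.mem_Ico]; exact ⟨by omega, ha⟩⟩
  rw [Finset.mem_filter, Finset.mem_Ico] at hg
  have hg' := h.shift_longest g
  have himg := h.image_range_shift g
  rw [← himg] at hd ⊢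
  refine hg'.degreeIn_add_le_of_path_aux hcol hP hPS hd hk hxy (f := f - g) hg.2 ?_ (by omega)
    (by omega) ?_ ?_
  · rwa [Nat.add_sub_cancel' hg.1.2.le]
  · exact fun i hi hi' => hfmin _ (by omega) (by omega)
  · intro i hi hi' hadj
    have := hgmax (g + i) (by rw [Finset.mem_filter, Finset.mem_Ico]; exact ⟨by omega, hadj⟩)
    simp only [id] at this
    omega

/-- The analogue of `degreeIn_add_le_of_path` for outside paths whose ends have the same colour. -/
lemma degreeIn_le_of_path (h : IsLongestSeq G S v (2 * c))
    (hcol : ∀ u v, G.Adj u v → col u ≠ col v) (hP : PathOn G x y P) (hPS : P ⊆ S)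
    (hd : Disjoint P ((Finset.range (2 * c)).image v)) (hr : P.card + 1 = 2 * r)
    (hxy : col x = col y)
    (hy : 0 < degreeIn G ((Finset.range (2 * c)).image v) y) :
    degreeIn G ((Finset.range (2 * c)).image v) x ≤ 1 + (c + 1 - 2 * r) := by
  obtain ⟨a, -, -, ha⟩ := exists_adj_of_degreeIn_pos h.toIsCyclicSeq hy 0
  have h' := h.shift_longest a
  have himg := h.image_range_shift a
  rw [← himg] at hd ⊢
  have hr0 : 0 < r := by omega
  set w := fun i => v (a + i) with hw
  have hn := h.three_le
  have hy0 : G.Adj y (w 0) := ha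
  have hyn : G.Adj y (w (2 * c)) := by
    have := h'.periodic 0
    rw [zero_add] at this
    rwa [this]
  rw [h'.degreeIn_eq 0 x]
  set A := (Finset.Ico 0 (0 + 2 * c)).filter fun i => G.Adj x (w i) with hA
  have hsub : A ⊆ insert 0 (A.filter (0 < ·)) := by
    intro i hi
    rw [Finset.mem_insert, Finset.mem_filter]
    rcases Nat.eq_zero_or_pos i with h1 | h1
    · exact Or.inl h1
    · exact Or.inr ⟨hi, h1⟩
  have h1 := (Finset.card_le_card hsub).trans (Finset.card_insert_le _ _)
  have h2 : (A.filter (0 < ·)).card ≤ c + 1 - 2 * r := by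
    have hprop : ∀ i ∈ A.filter (0 < ·), i % 2 = 0 ∧ 2 * r ≤ i ∧ i + 2 * r ≤ 2 * c := by
      intro i hi
      simp only [hA, Finset.mem_filter, Finset.mem_Ico] at hi
      have h1 := h'.gap hP.symm hPS hd hy0 hi.1.2 hi.2 (by omega)
      have h2 := h'.gap hP hPS hd hi.1.2 hyn (by omega) (by omega)
      have h3 := hcol _ _ hi.1.2
      have h4 := hcol _ _ hy0
      have := (h'.col_eq_iff hcol i 0).1 (by
        cases h5 : col y <;> cases h6 : col (w i) <;> cases h7 : col (w 0) <;> simp_all)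
      omega
    refine card_le_of_parity (a := 2 * r) (fun i hi => ?_) fun i hi j hj => ?_
    · have := hprop i hi
      rw [Finset.mem_Ico]
      omega
    · rw [(hprop i hi).1, (hprop j hj).1]
  omega

end IsLongestSeq
end Longest

section Matchings

variable {V : Type*} [DecidableEq V] {G : SimpleGraph V} [DecidableRel G.Adj] {col : V → Bool}

/-- Some path with vertex set `s` has adjacent ends: `s` carries a cycle or a single edge. -/
def RingOn (G : SimpleGraph V) (s : Finset V) : Prop := ∃ a b, PathOn G a b s ∧ G.Adj b a

lemma RingOn.cycleOn {s : Finset V} (h : RingOn G s) (hs : 3 ≤ s.card) : CycleOn G s :=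
  let ⟨a, b, hp, hadj⟩ := h
  ⟨a, b, hp, hadj, hs⟩

lemma RingOn.exists_path_from {s : Finset V} (h : RingOn G s) {v : V} (hv : v ∈ s) :
    ∃ u, PathOn G v u s ∧ G.Adj u v := by
  by_cases hs : 3 ≤ s.card
  · obtain ⟨w, hw, hws, rfl⟩ := (h.cycleOn hs).exists_seq_from hv
    have h1 := hw.segment (Nat.zero_le (s.card - 1)) (by omega)
    have h3 : Finset.Icc 0 (s.card - 1) = Finset.range s.card := by
      ext; simp only [Finset.mem_Icc, Finset.mem_range]; omega
    rw [h3, hws] at h1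
    refine ⟨_, h1, ?_⟩
    have := hw.adj (s.card - 1)
    rwa [show s.card - 1 + 1 = 0 + s.card by omega, hw.periodic] at this
  · obtain ⟨a, b, hp, hadj⟩ := h
    have hab : ({a, b} : Finset V) ⊆ s := by
      simp [Finset.insert_subset_iff, hp.left_mem, hp.right_mem]
    have hs2 : s = {a, b} := (Finset.eq_of_subset_of_card_le hab (by
      rw [Finset.card_pair hadj.ne.symm]; omega)).symm
    have hv' : v = a ∨ v = b := by rw [hs2] at hv; simpa using hv
    rcases hv' with rfl | rfl
    · exact ⟨b, hp, hadj⟩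
    · exact ⟨a, hp.symm, hadj.symm⟩

/-- The sequence `w` runs along a path with `n` vertices. -/
structure IsPathSeq (G : SimpleGraph V) (w : ℕ → V) (n : ℕ) : Prop where
  adj : ∀ i, i + 1 < n → G.Adj (w i) (w (i + 1))
  ne : ∀ i j, i < j → j < n → w i ≠ w j

lemma PathOn.exists_isPathSeq {a b : V} {s : Finset V} (h : PathOn G a b s) :
    ∃ w, IsPathSeq G w s.card ∧ w 0 = a ∧ w (s.card - 1) = b ∧
      (Finset.range s.card).image w = s :=
  let ⟨w, h0, hl, ha, hi, hs⟩ := h.exists_seq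
  ⟨w, ⟨ha, hi⟩, h0, hl, hs⟩

namespace IsPathSeq

variable {w : ℕ → V} {n : ℕ}

lemma injOn (h : IsPathSeq G w n) : Set.InjOn w (Finset.range n) := by
  intro i hi j hj hij
  simp only [Finset.coe_range, Set.mem_Iio] at hi hj
  by_contra hne
  rcases Nat.lt_or_gt_of_ne hne with h1 | h1
  · exact h.ne i j h1 hj hij
  · exact h.ne j i h1 hi hij.symm

lemma eq_of (h : IsPathSeq G w n) {i j : ℕ} (hi : i < n) (hj : j < n) (hij : w i = w j) : i = j :=
  h.injOn (by simpa using hi) (by simpa using hj) hij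

lemma segment (h : IsPathSeq G w n) {i j : ℕ} (hij : i ≤ j) (hj : j < n) :
    PathOn G (w i) (w j) ((Finset.Icc i j).image w) :=
  PathOn.segment w hij (fun k _ hk => h.adj k (by omega)) fun k l _ hkl hl => h.ne k l hkl (by omega)

lemma card_image (h : IsPathSeq G w n) {s : Finset ℕ} (hs : ∀ i ∈ s, i < n) :
    (s.image w).card = s.card :=
  Finset.card_image_of_injOn (h.injOn.mono fun i hi => by simpa using hs i hi)

lemma disjoint_image (h : IsPathSeq G w n) {s s' : Finset ℕ} (hs : ∀ i ∈ s, i < n)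
    (hs' : ∀ i ∈ s', i < n) (hd : Disjoint s s') : Disjoint (s.image w) (s'.image w) := by
  rw [Finset.disjoint_left] at hd ⊢
  intro x hx hx'
  obtain ⟨i, hi, rfl⟩ := Finset.mem_image.1 hx
  obtain ⟨j, hj, hij⟩ := Finset.mem_image.1 hx'
  exact hd hi (h.eq_of (hs' j hj) (hs i hi) hij ▸ hj)

lemma degreeIn_eq (h : IsPathSeq G w n) (x : V) :
    degreeIn G ((Finset.range n).image w) x =
      ((Finset.range n).filter fun i => G.Adj x (w i)).card := by
  rw [degreeIn, Finset.filter_image, h.card_image fun i hi => ?_]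
  exact Finset.mem_range.1 (Finset.mem_filter.1 hi).1

lemma col_eq_iff (hcol : ∀ u v, G.Adj u v → col u ≠ col v) (h : IsPathSeq G w n) {i j : ℕ}
    (hi : i < n) (hj : j < n) : col (w i) = col (w j) ↔ i % 2 = j % 2 := by
  have key : ∀ i < n, col (w i) = xor (col (w 0)) (decide (i % 2 = 1)) := by
    intro i
    induction i with
    | zero => simp
    | succ i ih =>
      intro hi
      have ih := ih (by omega)
      have h1 := hcol _ _ (h.adj i hi)
      rcases Nat.mod_two_eq_zero_or_one i with h2 | h2
      · have h3 : (i + 1) % 2 = 1 := by omega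
        cases h4 : col (w 0) <;> cases h5 : col (w i) <;> cases h6 : col (w (i + 1)) <;> simp_all
      · have h3 : (i + 1) % 2 = 0 := by omega
        cases h4 : col (w 0) <;> cases h5 : col (w i) <;> cases h6 : col (w (i + 1)) <;> simp_all
  rw [key i hi, key j hj]
  rcases Nat.mod_two_eq_zero_or_one i with h2 | h2 <;>
    rcases Nat.mod_two_eq_zero_or_one j with h3 | h3 <;> simp [h2, h3]

lemma parity_ne (hcol : ∀ u v, G.Adj u v → col u ≠ col v) (h : IsPathSeq G w n) {i j : ℕ}
    (hi : i < n) (hj : j < n) (hij : G.Adj (w i) (w j)) : i % 2 ≠ j % 2 :=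
  fun h' => hcol _ _ hij ((h.col_eq_iff hcol hi hj).2 h')

/-- Crossing chords from the two ends of a path close it to a cycle. -/
lemma ringOn (h : IsPathSeq G w n) {i : ℕ} (hi : i + 1 < n) (h0 : G.Adj (w 0) (w (i + 1)))
    (hn : G.Adj (w (n - 1)) (w i)) : RingOn G ((Finset.range n).image w) := by
  have p1 := h.segment (Nat.zero_le i) (by omega)
  have p2 := (h.segment (i := i + 1) (j := n - 1) (by omega) (by omega)).symm
  have hd : Disjoint ((Finset.Icc 0 i).image w) ((Finset.Icc (i + 1) (n - 1)).image w) := by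
    refine h.disjoint_image (fun k hk => ?_) (fun k hk => ?_) ?_
    · rw [Finset.mem_Icc] at hk; omega
    · rw [Finset.mem_Icc] at hk; omega
    · rw [Finset.disjoint_left]
      intro k hk hk'
      rw [Finset.mem_Icc] at hk hk'
      omega
  have hu : (Finset.range n).image w =
      (Finset.Icc 0 i).image w ∪ (Finset.Icc (i + 1) (n - 1)).image w := by
    rw [← Finset.image_union]
    congr 1
    ext k
    simp only [Finset.mem_range, Finset.mem_union, Finset.mem_Icc]
    omega
  rw [hu]
  exact ⟨_, _, p1.append p2 hn.symm hd, h0.symm⟩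

end IsPathSeq

/-- The ends of a path which does not close up have small degree sum into the path. -/
lemma PathOn.two_mul_degreeIn_le (hcol : ∀ u v, G.Adj u v → col u ≠ col v) {a b : V}
    {s : Finset V} (h : PathOn G a b s) (hab : col a ≠ col b) (hr : ¬ RingOn G s) :
    2 * (degreeIn G s a + degreeIn G s b) ≤ s.card := by
  have heven := h.two_mul_colourCount hcol hab (col a)
  obtain ⟨w, hw, rfl, rfl, hs⟩ := h.exists_isPathSeq
  set n := s.card with hn
  have hpos : 0 < n := Finset.card_pos.2 ⟨_, h.left_mem⟩
  set A := (Finset.range (n - 1)).filter fun i => G.Adj (w 0) (w (i + 1)) with hA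
  set B := (Finset.range n).filter fun i => G.Adj (w (n - 1)) (w i) with hB
  have hAc : degreeIn G s (w 0) ≤ A.card := by
    nth_rw 1 [← hs]
    rw [hw.degreeIn_eq, ← Finset.card_image_of_injective A (add_left_injective 1)]
    refine Finset.card_le_card fun i hi => ?_
    rw [Finset.mem_filter, Finset.mem_range] at hi
    rcases Nat.eq_zero_or_pos i with rfl | h1
    · exact absurd rfl hi.2.ne
    · rw [Finset.mem_image]
      refine ⟨i - 1, ?_, by omega⟩
      rw [Finset.mem_filter, Finset.mem_range, Nat.sub_add_cancel h1]
      exact ⟨by omega, hi.2⟩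
  have hBc : degreeIn G s (w (n - 1)) = B.card := by
    nth_rw 1 [← hs]
    rw [hw.degreeIn_eq]
  have hd : Disjoint A B := by
    rw [Finset.disjoint_left]
    intro i hi hi'
    rw [Finset.mem_filter, Finset.mem_range] at hi hi'
    have := hw.ringOn (i := i) (by omega) hi.2 hi'.2
    rw [hs] at this
    exact hr this
  have hpar : ∀ i ∈ A ∪ B, i % 2 = 0 ∧ i < n := by
    intro i hi
    have hlast := (hw.col_eq_iff hcol (i := 0) (j := n - 1) hpos (by omega)).not.1 hab
    rcases Finset.mem_union.1 hi with hi | hi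
    · rw [Finset.mem_filter, Finset.mem_range] at hi
      have := hw.parity_ne hcol hpos (by omega) hi.2
      omega
    · rw [Finset.mem_filter, Finset.mem_range] at hi
      have := hw.parity_ne hcol (by omega) hi.1 hi.2
      omega
  have hle : (A ∪ B).card ≤ colourCount col (col (w 0)) s := by
    refine card_le_of_parity (a := 0) (fun i hi => ?_) fun i hi j hj => ?_
    · have := hpar i hi
      rw [Finset.mem_Ico]
      omega
    · rw [(hpar i hi).1, (hpar j hj).1]
  rw [Finset.card_union_of_disjoint hd] at hle
  omega

/-- The subgraph induced on `R` has a perfect matching. -/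
def HasPerfectMatching (G : SimpleGraph V) (R : Finset V) : Prop :=
  ∃ μ : V → V, ∀ v ∈ R, μ v ∈ R ∧ μ (μ v) = v ∧ G.Adj v (μ v)

lemma HasPerfectMatching.exists_erase {R : Finset V} (h : HasPerfectMatching G R) {u : V}
    (hu : u ∈ R) : ∃ x ∈ R, G.Adj u x ∧ HasPerfectMatching G (R \ {x, u}) := by
  obtain ⟨μ, hμ⟩ := h
  refine ⟨μ u, (hμ u hu).1, (hμ u hu).2.2, μ, fun v hv => ?_⟩
  simp only [Finset.mem_sdiff, Finset.mem_insert, Finset.mem_singleton, not_or] at hv ⊢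
  obtain ⟨h1, h2, h3⟩ := hμ v hv.1
  refine ⟨⟨h1, fun h => hv.2.2 ?_, fun h => hv.2.1 ?_⟩, h2, h3⟩
  · rw [← h2, h, (hμ u hu).2.1]
  · rw [← h, h2]

/-- In a set with a perfect matching there is a path, compatible with the matching, which is
maximal in the sense that it cannot be extended. -/
lemma HasPerfectMatching.exists_maximal_path (hcol : ∀ u v, G.Adj u v → col u ≠ col v)
    {R : Finset V} (h : HasPerfectMatching G R) (hR : R.Nonempty) :
    ∃ a b l, PathOn G a b l ∧ l ⊆ R ∧ col a ≠ col b ∧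
      (∀ u ∈ R \ l, ¬ G.Adj a u ∧ ¬ G.Adj b u) ∧
      (RingOn G l → ∀ u ∈ R \ l, ∀ v ∈ l, ¬ G.Adj v u) := by
  classical
  set F := R.powerset.filter fun l =>
    (∃ a b, PathOn G a b l ∧ col a ≠ col b) ∧ HasPerfectMatching G (R \ l) with hF
  have hFne : F.Nonempty := by
    obtain ⟨u, hu⟩ := hR
    obtain ⟨x, hx, hux, hm⟩ := h.exists_erase hu
    refine ⟨{x, u}, ?_⟩
    rw [Finset.mem_filter, Finset.mem_powerset]
    refine ⟨by simp [Finset.insert_subset_iff, hx, hu], ⟨x, u, ?_, (hcol _ _ hux).symm⟩, hm⟩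
    exact .cons hux.symm (by simpa using hux.ne.symm) (.single u)
  obtain ⟨l, hl, hmax⟩ := Finset.exists_max_image F Finset.card hFne
  rw [Finset.mem_filter, Finset.mem_powerset] at hl
  obtain ⟨hlR, ⟨a, b, hp, hab⟩, hm⟩ := hl
  have ext : ∀ a b, PathOn G a b l → col a ≠ col b → ∀ u ∈ R \ l, ¬ G.Adj a u := by
    intro a b hp hab u hu hau
    obtain ⟨x, hx, hux, hm'⟩ := hm.exists_erase hu
    have hu' := Finset.mem_sdiff.1 hu
    have hx' := Finset.mem_sdiff.1 hx
    have hxn : x ∉ insert u l := by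
      rw [Finset.mem_insert]
      rintro (rfl | h)
      · exact hux.ne rfl
      · exact hx'.2 h
    have hp' := PathOn.cons hux.symm hxn (PathOn.cons hau.symm hu'.2 hp)
    have := hmax (insert x (insert u l)) (by
      rw [Finset.mem_filter, Finset.mem_powerset]
      refine ⟨Finset.insert_subset hx'.1 (Finset.insert_subset hu'.1 hlR), ⟨x, b, hp', ?_⟩, ?_⟩
      · have h1 := hcol _ _ hux
        have h2 := hcol _ _ hau
        cases h3 : col x <;> cases h4 : col u <;> cases h5 : col a <;> cases h6 : col b <;>
          simp_all
      · convert hm' using 1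
        ext v
        simp only [Finset.mem_sdiff, Finset.mem_insert, Finset.mem_singleton]
        tauto)
    rw [Finset.card_insert_of_notMem hxn, Finset.card_insert_of_notMem hu'.2] at this
    omega
  refine ⟨a, b, l, hp, hlR, hab, fun u hu => ⟨ext a b hp hab u hu, ext b a hp.symm hab.symm u hu⟩,
    fun hr u hu v hv => ?_⟩
  obtain ⟨y, hy, hyv⟩ := hr.exists_path_from hv
  exact ext v y hy (hcol _ _ hyv).symm u hu

lemma exists_injOn_of_hall (X : Finset V) (N : V → Finset V)
    (h : ∀ A ⊆ X, A.card ≤ (A.biUnion N).card) :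
    ∃ f : V → V, Set.InjOn f X ∧ ∀ x ∈ X, f x ∈ N x := by
  have h1 := (Finset.all_card_le_biUnion_card_iff_exists_injective
    (fun x : {x // x ∈ X} => N x)).1 fun s => by
      have h2 := h (s.map (Function.Embedding.subtype _)) (fun x hx => by
        obtain ⟨y, -, rfl⟩ := Finset.mem_map.1 hx
        exact y.2)
      rw [Finset.card_map] at h2
      refine h2.trans (Finset.card_le_card fun x hx => ?_)
      simp only [Finset.mem_biUnion, Finset.mem_map, Function.Embedding.subtype_apply] at hx ⊢
      obtain ⟨_, ⟨y, hy, rfl⟩, hx⟩ := hx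
      exact ⟨y, hy, hx⟩
  obtain ⟨f, hf, hfN⟩ := h1
  refine ⟨fun v => if hv : v ∈ X then f ⟨v, hv⟩ else v, fun x hx y hy hxy => ?_, fun x hx => ?_⟩
  · simp only [Finset.mem_coe] at hx hy
    simp only [hx, hy, dif_pos] at hxy
    exact congrArg Subtype.val (hf hxy)
  · simpa only [hx, dif_pos] using hfN ⟨x, hx⟩

/-- Hall's theorem for a balanced bipartite vertex set. -/
lemma hasPerfectMatching_of_hall (hcol : ∀ u v, G.Adj u v → col u ≠ col v) {S : Finset V}
    (b : Bool) (hbal : colourCount col b S = colourCount col (!b) S)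
    (h : ∀ A ⊆ S.filter (col · = b), A.card ≤ (A.biUnion fun x => S.filter (G.Adj x)).card) :
    HasPerfectMatching G S := by
  obtain ⟨f, hf, hfN⟩ := exists_injOn_of_hall _ _ h
  set X := S.filter (col · = b) with hX
  set Y := S.filter (col · = !b) with hY
  have hfY : X.image f = Y := by
    refine Finset.eq_of_subset_of_card_le (fun y hy => ?_) ?_
    · obtain ⟨x, hx, rfl⟩ := Finset.mem_image.1 hy
      have h1 := Finset.mem_filter.1 (hfN x hx)
      have h2 := Finset.mem_filter.1 hx
      have h3 := hcol _ _ h1.2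
      rw [hY, Finset.mem_filter]
      refine ⟨h1.1, ?_⟩
      cases h4 : col (f x) <;> cases h5 : col x <;> cases b <;> simp_all
    · rw [Finset.card_image_of_injOn hf]
      exact hbal.symm.le
  have hg : ∀ y ∈ Y, ∃ x ∈ X, f x = y := fun y hy => by
    rw [← hfY] at hy
    simpa using hy
  choose! g hgX hgf using hg
  have hgfx : ∀ x ∈ X, g (f x) = x := fun x hx => by
    have hy : f x ∈ Y := hfY ▸ Finset.mem_image_of_mem _ hx
    exact hf (by simpa using hgX _ hy) (by simpa using hx) (hgf _ hy)
  refine ⟨fun v => if col v = b then f v else g v, fun v hv => ?_⟩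
  by_cases hvb : col v = b
  · have hx : v ∈ X := Finset.mem_filter.2 ⟨hv, hvb⟩
    have h1 := Finset.mem_filter.1 (hfN v hx)
    have h2 : col (f v) ≠ b := fun h => hcol _ _ h1.2 (hvb.trans h.symm)
    simp only [hvb, h2, if_true, if_false]
    exact ⟨h1.1, hgfx v hx, h1.2⟩
  · have hy : v ∈ Y := Finset.mem_filter.2 ⟨hv, by cases h : col v <;> cases b <;> simp_all⟩
    have h1 := Finset.mem_filter.1 (hgX v hy)
    simp only [hvb, h1.2, if_true, if_false]
    refine ⟨h1.1, hgf v hy, ?_⟩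
    have := (Finset.mem_filter.1 (hfN _ (hgX v hy))).2
    rw [hgf v hy] at this
    exact this.symm

end Matchings

section Slack

variable {V : Type*} [DecidableEq V] {G : SimpleGraph V} [DecidableRel G.Adj] {col : V → Bool}

/-- A balanced bipartite set in which non-adjacent vertices of different colours have large degree
sum has a perfect matching. -/
lemma hasPerfectMatching_of_degreeIn (hcol : ∀ u v, G.Adj u v → col u ≠ col v) {H : Finset V}
    {r : ℕ} (hbal : ∀ b, colourCount col b H = r)
    (hdeg : ∀ x ∈ H, ∀ y ∈ H, col x ≠ col y → r ≤ degreeIn G H x + degreeIn G H y) :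
    HasPerfectMatching G H := by
  refine hasPerfectMatching_of_hall hcol true (by rw [hbal, hbal]) fun A hA => ?_
  by_contra! hlt
  set N := A.biUnion fun x => H.filter (G.Adj x) with hN
  obtain ⟨x, hx⟩ : A.Nonempty := Finset.card_pos.1 (by omega)
  have hAr : A.card ≤ r := (Finset.card_le_card hA).trans (hbal true).le
  obtain ⟨y, hyY, hyN⟩ : ∃ y ∈ H.filter (col · = false), y ∉ N := by
    by_contra! hcon
    have := Finset.card_le_card (show H.filter (col · = false) ⊆ N from hcon)
    have h2 := hbal false
    unfold colourCount at h2
    omega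
  rw [Finset.mem_filter] at hyY
  have hx' := Finset.mem_filter.1 (hA hx)
  have h1 : degreeIn G H x ≤ N.card := Finset.card_le_card fun u hu =>
    Finset.mem_biUnion.2 ⟨x, hx, hu⟩
  have h2 : degreeIn G H y + A.card ≤ r := by
    rw [← hbal true, colourCount, degreeIn, ← Finset.card_union_of_disjoint]
    · refine Finset.card_le_card (Finset.union_subset (fun u hu => ?_) hA)
      rw [Finset.mem_filter] at hu ⊢
      have := hcol _ _ hu.2
      exact ⟨hu.1, by cases h : col u <;> simp_all⟩
    · rw [Finset.disjoint_left]
      intro u hu huA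
      rw [Finset.mem_filter] at hu
      exact hyN (Finset.mem_biUnion.2 ⟨u, huA, Finset.mem_filter.2 ⟨hyY.1, hu.2.symm⟩⟩)
  have := hdeg x hx'.1 y hyY.1 (by rw [hx'.2, hyY.2]; decide)
  omega

namespace IsLongestSeq

variable {S : Finset V} {v : ℕ → V} {c j : ℕ}

lemma false_of_degreeIn (h : IsLongestSeq G S v (2 * c))
    (hcol : ∀ u v, G.Adj u v → col u ≠ col v) (hbal : ∀ b, colourCount col b S = j)
    (hcj : c < j) (hjc : j + 2 ≤ 2 * c)
    (hdeg : ∀ x ∈ S \ (Finset.range (2 * c)).image v, ∀ y ∈ S \ (Finset.range (2 * c)).image v,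
      col x ≠ col y → j + 1 + (if G.Adj x y then 1 else 0) ≤ degreeIn G S x + degreeIn G S y) :
    False := by
  set C := (Finset.range (2 * c)).image v with hC
  have hCS : C ⊆ S := h.image_subset _
  set H := S \ C with hH
  have hHS : H ⊆ S := Finset.sdiff_subset
  have hCc : ∀ b, colourCount col b C = c := fun b => by
    have h1 : 2 * colourCount col b C = C.card := h.cycleOn.colourCount_eq hcol b
    have h2 : C.card = 2 * c := h.card_image_range
    omega
  obtain ⟨r, rfl⟩ : ∃ r, j = c + r := ⟨j - c, by omega⟩
  have hHc : ∀ b, colourCount col b H = r := fun b => by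
    have h1 : colourCount col b H + colourCount col b C = colourCount col b S :=
      colourCount_sdiff hCS b
    rw [hCc, hbal] at h1
    omega
  have hcH : H.card = 2 * r := by
    have := colourCount_add col true H
    rw [hHc, hHc] at this
    omega
  have hd : ∀ x, degreeIn G S x = degreeIn G H x + degreeIn G C x := fun x =>
    (degreeIn_sdiff hCS x).symm
  have hp : ∀ x, degreeIn G C x ≤ c := fun x => (degreeIn_le_colourCount hcol C x).trans (hCc _).le
  have hdH : ∀ x, degreeIn G H x ≤ r := fun x => (degreeIn_le_colourCount hcol H x).trans (hHc _).le
  have hdisj : ∀ P ⊆ H, Disjoint P C := fun P hP =>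
    Finset.disjoint_of_subset_left hP Finset.sdiff_disjoint
  have hpath : ∀ x y P k, PathOn G x y P → P ⊆ H → P.card = 2 * k → col x ≠ col y →
      degreeIn G C x = 0 ∨ degreeIn G C y = 0 ∨ degreeIn G C x + degreeIn G C y + k ≤ c + 1 := by
    intro x y P k hP hPH hk hxy
    by_cases hx : degreeIn G C x = 0
    · exact Or.inl hx
    by_cases hy : degreeIn G C y = 0
    · exact Or.inr (Or.inl hy)
    · exact Or.inr (Or.inr (h.degreeIn_add_le_of_path hcol hP (hPH.trans hHS) (hdisj P hPH) hk hxy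
        (Nat.pos_of_ne_zero hx) (Nat.pos_of_ne_zero hy)))
  have hnon : ∀ x ∈ H, ∀ y ∈ H, col x ≠ col y → r ≤ degreeIn G H x + degreeIn G H y := by
    intro x hx y hy hxy
    have h1 : degreeIn G C x + degreeIn G C y ≤ c + 1 := h.degreeIn_add_le hcol (hHS hx) (hHS hy) (Finset.mem_sdiff.1 hx).2
      (Finset.mem_sdiff.1 hy).2 hxy
    have h2 := hdeg x hx y hy hxy
    rw [hd x, hd y] at h2
    omega
  have hadj : ∀ x ∈ H, ∀ y ∈ H, G.Adj x y → r + 2 ≤ degreeIn G H x + degreeIn G H y := by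
    intro x hx y hy hxy
    have h1 := hpath x y {x, y} 1 (.cons hxy (by simpa using hxy.ne) (.single y))
      (by simp [Finset.insert_subset_iff, hx, hy]) (Finset.card_pair hxy.ne) (hcol _ _ hxy)
    have h2 := hdeg x hx y hy (hcol _ _ hxy)
    rw [hd x, hd y, if_pos hxy] at h2
    have h3 := hp x
    have h4 := hp y
    omega
  have hHne : H.Nonempty := Finset.card_pos.1 (by omega)
  obtain ⟨a, b, l, hl, hlH, hab, hmax, hring⟩ :=
    (hasPerfectMatching_of_degreeIn hcol hHc hnon).exists_maximal_path hcol hHne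
  have hll : ∀ x, (∀ u ∈ H \ l, ¬ G.Adj x u) → degreeIn G H x = degreeIn G l x := by
    intro x hx
    rw [← degreeIn_sdiff hlH x, degreeIn, Finset.card_eq_zero.2, zero_add]
    rwa [Finset.filter_eq_empty_iff]
  have hlc := Finset.card_le_card hlH
  have haH := hlH hl.left_mem
  have hbH := hlH hl.right_mem
  by_cases hr : RingOn G l
  · have hring := hring hr
    by_cases hne : (H \ l).Nonempty
    · have hlk : ∀ d, colourCount col d l = colourCount col true l := fun d => by
        have h1 := hl.two_mul_colourCount hcol hab d
        have h2 := hl.two_mul_colourCount hcol hab true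
        omega
      set k := colourCount col true l with hk
      have hHlk : ∀ d, colourCount col d (H \ l) = r - k := fun d => by
        have h1 := colourCount_sdiff (col := col) hlH d
        rw [hHc, hlk] at h1
        omega
      have hkr : k ≤ r := by rw [← hHc true]; exact colourCount_mono hlH _
      have d1 : ∀ x ∈ l, degreeIn G H x ≤ k := fun x hx => by
        rw [hll x fun u hu => hring u hu x hx, ← hlk (!col x)]
        exact degreeIn_le_colourCount hcol l x
      have d2 : ∀ x ∈ H \ l, degreeIn G H x ≤ r - k := fun x hx => by
        rw [← degreeIn_sdiff hlH x, ← hHlk (!col x)]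
        have : degreeIn G l x = 0 := by
          rw [degreeIn, Finset.card_eq_zero, Finset.filter_eq_empty_iff]
          exact fun u hu hadj => hring x hx u hu hadj.symm
        rw [this]
        exact degreeIn_le_colourCount hcol (H \ l) x
      have e1 : r + 2 ≤ 2 * k := by
        obtain ⟨a', b', hl', hadj'⟩ := hr
        have := hadj b' (hlH hl'.right_mem) a' (hlH hl'.left_mem) hadj'
        have := d1 _ hl'.right_mem
        have := d1 _ hl'.left_mem
        omega
      obtain ⟨u, hu⟩ := hne
      have huH := (Finset.mem_sdiff.1 hu).1
      obtain ⟨x, hx, hxu⟩ : ∃ x ∈ l, col x ≠ col u := by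
        by_cases h1 : col a = col u
        · exact ⟨b, hl.right_mem, h1 ▸ hab.symm⟩
        · exact ⟨a, hl.left_mem, h1⟩
      have h1 := hnon x (hlH hx) u huH hxu
      have h2 := d1 x hx
      have h3 := d2 u hu
      have h4 : 0 < r - k := by
        rw [← hHlk (col u)]
        exact Finset.card_pos.2 ⟨u, Finset.mem_filter.2 ⟨hu, rfl⟩⟩
      obtain ⟨u', hu'⟩ := Finset.card_pos.1 (show 0 < degreeIn G H u by omega)
      rw [Finset.mem_filter] at hu'
      have hu'l : u' ∉ l := fun hm => hring u hu u' hm hu'.2.symm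
      have h5 := hadj u huH u' hu'.1 hu'.2
      have h6 := d2 u' (Finset.mem_sdiff.2 ⟨hu'.1, hu'l⟩)
      omega
    · have hlH' : l = H := by
        rw [Finset.not_nonempty_iff_eq_empty, Finset.sdiff_eq_empty_iff_subset] at hne
        exact hlH.antisymm hne
      subst hlH'
      have hr2 : 2 ≤ r := by
        obtain ⟨a', b', hl', hadj'⟩ := hr
        have := hadj b' hl'.right_mem a' hl'.left_mem hadj'
        have := hdH a'
        have := hdH b'
        omega
      obtain ⟨u, hu, hul⟩ := (hr.cycleOn (by omega)).exists_seq
      rw [hcH] at hu hul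
      have humem : ∀ i, u i ∈ H := fun i => by rw [← hul]; exact hu.mem_image_range i
      have hcons : ∀ i, (degreeIn G C (u i) = 0 ∧ c + 2 ≤ degreeIn G C (u (i + 1)) + r) ∨
          (degreeIn G C (u (i + 1)) = 0 ∧ c + 2 ≤ degreeIn G C (u i) + r) := by
        intro i
        have h0 := hu.adj i
        have h1 := hdeg _ (humem i) _ (humem (i + 1)) (hcol _ _ h0)
        rw [if_pos h0, hd, hd] at h1
        have h2 := hdH (u i)
        have h3 := hdH (u (i + 1))
        have p1 := hu.segment (i := i + 1) (j := i + 2 * r) (by omega) (by omega)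
        have c1 := hu.card_image (i := i + 1) (j := i + 2 * r) (by omega)
        rw [hu.periodic] at p1
        have s1 : (Finset.Icc (i + 1) (i + 2 * r)).image u ⊆ H := by
          rw [← hul]; exact hu.segment_subset _
        have := hpath _ _ _ r p1.symm s1 (by omega) (hcol _ _ h0)
        omega
      obtain ⟨i, hi, hi2⟩ : ∃ i, c + 2 ≤ degreeIn G C (u i) + r ∧
          c + 2 ≤ degreeIn G C (u (i + 2)) + r := by
        have h0 := hcons 0
        have h1 := hcons 1
        have h2 := hcons 2
        simp only [Nat.reduceAdd, zero_add] at h0 h1 h2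
        by_cases hz : degreeIn G C (u 0) = 0
        · exact ⟨1, by omega, by simp only [Nat.reduceAdd]; omega⟩
        · exact ⟨0, by omega, by simp only [Nat.reduceAdd]; omega⟩
      have p1 := hu.segment (i := i + 2) (j := i + 2 * r) (by omega) (by omega)
      have c1 := hu.card_image (i := i + 2) (j := i + 2 * r) (by omega)
      rw [hu.periodic] at p1
      have s1 : (Finset.Icc (i + 2) (i + 2 * r)).image u ⊆ H := by
        rw [← hul]; exact hu.segment_subset _
      have : degreeIn G C (u i) ≤ 1 + (c + 1 - 2 * r) :=
        h.degreeIn_le_of_path hcol p1.symm (s1.trans hHS) (hdisj _ s1) (by omega)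
          ((hu.col_eq_iff hcol _ _).2 (by omega))
          (show 0 < degreeIn G C (u (i + 2)) by omega)
      omega
  · have h1 := hl.two_mul_degreeIn_le hcol hab hr
    rw [← hll a fun u hu => (hmax u hu).1, ← hll b fun u hu => (hmax u hu).2] at h1
    have h2 := hnon a haH b hbH hab
    have h3 := hpath a b l r hl hlH (by omega) hab
    have h4 := hdeg a haH b hbH hab
    rw [hd, hd] at h4
    have := hp a
    have := hp b
    omega

/-- A balanced bipartite vertex set of moderate size with a sufficiently long longest cycle and
sufficiently many edges has shorter cycles too. -/
lemma hasCycle (hcol : ∀ u v, G.Adj u v → col u ≠ col v) {t : ℕ} (ht : 2 ≤ t) (htc : t ≤ c)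
    (h : IsLongestSeq G S v (2 * c)) (hbal : ∀ b, colourCount col b S = j) (hjt : j + 2 ≤ 2 * t)
    (he : j * (j + 1) < degreeSum G S) : HasCycle G S (2 * t) := by
  induction j generalizing S with
  | zero =>
    have := degreeSum_le_mul (G := G) hcol S true
    rw [hbal, hbal] at this
    omega
  | succ j ih =>
    set C := (Finset.range (2 * c)).image v with hC
    have hn := h.three_le
    have hCS : C ⊆ S := h.image_subset _
    have hCc : C.card = 2 * c := h.card_image_range
    have hSc : S.card = 2 * (j + 1) := by
      have := colourCount_add col true S
      rw [hbal, hbal] at this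
      omega
    have hcj := Finset.card_le_card hCS
    rcases Nat.lt_or_ge c (j + 1) with hlt | hge
    · have hex : ∃ x ∈ S \ C, ∃ y ∈ S \ C, col x ≠ col y ∧
          degreeIn G S x + degreeIn G S y < j + 1 + 1 + (if G.Adj x y then 1 else 0) := by
        by_contra! hcon
        exact h.false_of_degreeIn hcol hbal hlt (by omega) hcon
      obtain ⟨x, hx, y, hy, hxy, hlt⟩ := hex
      rw [Finset.mem_sdiff] at hx hy
      have hne : x ≠ y := fun h => hxy (h ▸ rfl)
      have hyx : y ∈ S.erase x := Finset.mem_erase.2 ⟨hne.symm, hy.1⟩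
      have hsub : (S.erase x).erase y ⊆ S :=
        (Finset.erase_subset _ _).trans (Finset.erase_subset _ _)
      have hsum := degreeSum_erase_erase (G := G) hx.1 hy.1 hne
      simp only [G.adj_comm y x] at hsum
      refine (ih (S := (S.erase x).erase y) ⟨h.toIsCyclicSeq, fun i => ?_, fun s hs =>
        h.card_le s (hs.trans hsub)⟩ (fun b => ?_) (by omega) ?_).mono hsub
      · have hi : v i ∈ C := h.mem_image_range i
        rw [Finset.mem_erase, Finset.mem_erase]
        exact ⟨fun h => hy.2 (h ▸ hi), fun h => hx.2 (h ▸ hi), hCS hi⟩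
      · have h1 := colourCount_erase (col := col) hyx b
        have h2 := colourCount_erase (col := col) hx.1 b
        rw [hbal] at h2
        cases b <;> cases h3 : col x <;> cases h4 : col y <;> simp_all
      · nlinarith
    · have hCS' : C = S := Finset.eq_of_subset_of_card_le hCS (by omega)
      have hc : c = j + 1 := by rw [hCS'] at hCc; omega
      subst hc
      have := h.cycleOn
      rw [← hC, hCS'] at this
      exact this.hasCycle_of_degreeSum hcol hSc ht htc he

end IsLongestSeq
end Slack

section Vine

variable {V : Type*} [DecidableEq V] {G : SimpleGraph V} [DecidableRel G.Adj] {col : V → Bool}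

/-- The subgraph induced on `R` is connected (or `R` is empty), in terms of cuts. -/
def Linked (G : SimpleGraph V) (R : Finset V) : Prop :=
  ∀ U ⊆ R, U.Nonempty → (R \ U).Nonempty → ∃ u ∈ U, ∃ v ∈ R \ U, G.Adj u v

/-- Disjoint sets in a connected graph are joined by a path without inner vertices in these
sets. -/
lemma Linked.exists_path {R A B : Finset V} (h : Linked G R) (hA : A ⊆ R) (hB : B ⊆ R)
    (hAB : Disjoint A B) (hA' : A.Nonempty) (hB' : B.Nonempty) :
    ∃ a ∈ A, ∃ b ∈ B, ∃ P ⊆ R, PathOn G a b P ∧ (∀ v ∈ P, v ∈ A → v = a) ∧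
      ∀ v ∈ P, v ∈ B → v = b := by
  classical
  set Q := (R \ B).filter fun v => ∃ a ∈ A, ∃ P ⊆ R \ B, PathOn G a v P ∧ ∀ u ∈ P, u ∈ A → u = a
    with hQ
  have hAQ : A ⊆ Q := fun a ha => by
    have : a ∈ R \ B := Finset.mem_sdiff.2 ⟨hA ha, Finset.disjoint_left.1 hAB ha⟩
    exact Finset.mem_filter.2 ⟨this, a, ha, {a}, by simpa using this, .single a, by simp⟩
  obtain ⟨b₀, hb₀⟩ := hB'
  obtain ⟨u, hu, v, hv, huv⟩ := h Q ((Finset.filter_subset _ _).trans Finset.sdiff_subset)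
    (hA'.mono hAQ) ⟨b₀, Finset.mem_sdiff.2 ⟨hB hb₀, fun hm =>
      (Finset.mem_sdiff.1 (Finset.mem_filter.1 hm).1).2 hb₀⟩⟩
  obtain ⟨-, a, ha, P, hPR, hP, hPA⟩ := Finset.mem_filter.1 hu
  rw [Finset.mem_sdiff] at hv
  have hvA : v ∉ A := fun hm => hv.2 (hAQ hm)
  have hPA' : ∀ x ∈ insert v P, x ∈ A → x = a := fun x hx hxA => by
    rcases Finset.mem_insert.1 hx with rfl | hx
    · exact absurd hxA hvA
    · exact hPA x hx hxA
  by_cases hvB : v ∈ B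
  · have hvP : v ∉ P := fun hm => (Finset.mem_sdiff.1 (hPR hm)).2 hvB
    refine ⟨a, ha, v, hvB, insert v P, Finset.insert_subset hv.1 (hPR.trans Finset.sdiff_subset),
      hP.snoc huv hvP, hPA', fun x hx hxB => ?_⟩
    rcases Finset.mem_insert.1 hx with rfl | hx
    · rfl
    · exact absurd hxB (Finset.mem_sdiff.1 (hPR hx)).2
  · have hvR : v ∈ R \ B := Finset.mem_sdiff.2 ⟨hv.1, hvB⟩
    refine absurd (Finset.mem_filter.2 ⟨hvR, ?_⟩) hv.2
    by_cases hvP : v ∈ P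
    · obtain ⟨p, hp, hp'⟩ := hP.prefix_to hvP
      exact ⟨a, ha, p, hp.trans hPR, hp', fun x hx => hPA x (hp hx)⟩
    · exact ⟨a, ha, _, Finset.insert_subset hvR hPR, hP.snoc huv hvP, hPA'⟩

/-- A pair of disjoint paths from `w s` and some `w a`, `a < s`, to `w j` and some `w q`, `q > j`,
which meet the sequence `w` only in prescribed positions. -/
def IsVine (G : SimpleGraph V) (S : Finset V) (w : ℕ → V) (n s j : ℕ) : Prop :=
  ∃ q a σ σ' P Q, j < q ∧ q < n ∧ a < s ∧ (σ = s ∧ σ' = a ∨ σ = a ∧ σ' = s) ∧ P ⊆ S ∧ Q ⊆ S ∧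
    Disjoint P Q ∧ PathOn G (w σ) (w j) P ∧ PathOn G (w σ') (w q) Q ∧
    ∀ i < n, w i ∈ P ∪ Q → s < i ∧ i < j ∨ i = s ∨ i = a ∨ i = j ∨ i = q

variable {S : Finset V} {w : ℕ → V} {n s s' j : ℕ}

lemma isVine_base (h2 : ∀ z ∈ S, Linked G (S.erase z)) (hw : IsPathSeq G w n)
    (hwS : ∀ i < n, w i ∈ S) (hs : 0 < s) (hsn : s + 1 < n) : IsVine G S w n s s := by
  have hmem : ∀ i < n, i ≠ s → w i ∈ S.erase (w s) := fun i hi his =>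
    Finset.mem_erase.2 ⟨fun h => his (hw.eq_of hi (by omega) h), hwS i hi⟩
  obtain ⟨x, hx, y, hy, P, hPR, hP, hPA, hPB⟩ :=
    (h2 (w s) (hwS s (by omega))).exists_path (A := (Finset.range s).image w)
      (B := (Finset.Ico (s + 1) n).image w)
      (fun x hx => by
        obtain ⟨i, hi, rfl⟩ := Finset.mem_image.1 hx
        rw [Finset.mem_range] at hi
        exact hmem i (by omega) (by omega))
      (fun x hx => by
        obtain ⟨i, hi, rfl⟩ := Finset.mem_image.1 hx
        rw [Finset.mem_Ico] at hi
        exact hmem i (by omega) (by omega))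
      (hw.disjoint_image (fun i hi => by rw [Finset.mem_range] at hi; omega)
        (fun i hi => by rw [Finset.mem_Ico] at hi; omega) (by
          rw [Finset.disjoint_left]
          intro i hi hi'
          rw [Finset.mem_range] at hi
          rw [Finset.mem_Ico] at hi'
          omega))
      ⟨w 0, Finset.mem_image_of_mem _ (by simpa using hs)⟩
      ⟨w (s + 1), Finset.mem_image_of_mem _ (by simpa using hsn)⟩
  obtain ⟨a, ha, rfl⟩ := Finset.mem_image.1 hx
  obtain ⟨q, hq, rfl⟩ := Finset.mem_image.1 hy
  rw [Finset.mem_range] at ha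
  rw [Finset.mem_Ico] at hq
  have hsP : w s ∉ P := fun hm => (Finset.mem_erase.1 (hPR hm)).1 rfl
  refine ⟨q, a, s, a, {w s}, P, by omega, hq.2, ha, Or.inl ⟨rfl, rfl⟩,
    by simpa using hwS s (by omega), hPR.trans (Finset.erase_subset _ _), by simpa using hsP,
    .single _, hP, fun i hi hiP => ?_⟩
  rw [Finset.mem_union, Finset.mem_singleton] at hiP
  rcases hiP with h | h
  · have := hw.eq_of hi (by omega) h
    omega
  · rcases lt_trichotomy i s with h1 | h1 | h1
    · have := hw.eq_of hi (by omega)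
        (hPA _ h (Finset.mem_image_of_mem _ (by simpa using h1)))
      omega
    · omega
    · have := hw.eq_of hi (by omega)
        (hPB _ h (Finset.mem_image_of_mem _ (by rw [Finset.mem_Ico]; omega)))
      omega

lemma IsVine.succ (h2 : ∀ z ∈ S, Linked G (S.erase z)) (hw : IsPathSeq G w n)
    (hwS : ∀ i < n, w i ∈ S) (hsj : s ≤ j) (hjn : j + 2 < n) (h : IsVine G S w n s j) :
    IsVine G S w n s (j + 1) := by
  obtain ⟨q, a, σ, σ', P, Q, hjq, hqn, has, hσ, hPS, hQS, hPQ, hP, hQ, hidx⟩ := h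
  have hPQ' := Finset.disjoint_left.1 hPQ
  have hadj := hw.adj j (by omega)
  have hzS := hwS (j + 1) (by omega)
  have hidxP : ∀ i < n, w i ∈ P → s < i ∧ i < j ∨ i = s ∨ i = a ∨ i = j ∨ i = q := fun i hi h =>
    hidx i hi (Finset.mem_union_left _ h)
  have hidxQ : ∀ i < n, w i ∈ Q → s < i ∧ i < j ∨ i = s ∨ i = a ∨ i = j ∨ i = q := fun i hi h =>
    hidx i hi (Finset.mem_union_right _ h)
  rcases Nat.lt_or_ge (j + 1) q with hq | hq
  · have hn : ∀ R : Finset V, (∀ i < n, w i ∈ R → s < i ∧ i < j ∨ i = s ∨ i = a ∨ i = j ∨ i = q) →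
        w (j + 1) ∉ R := fun R hR hm => by
      have := hR (j + 1) (by omega) hm
      omega
    refine ⟨q, a, σ, σ', insert (w (j + 1)) P, Q, hq, hqn, has, hσ, Finset.insert_subset hzS hPS,
      hQS, ?_, hP.snoc hadj (hn P hidxP), hQ, fun i hi hiP => ?_⟩
    · rw [Finset.disjoint_insert_left]
      exact ⟨hn Q hidxQ, hPQ⟩
    · rw [Finset.insert_union, Finset.mem_insert] at hiP
      rcases hiP with h | h
      · have := hw.eq_of hi (by omega) h
        omega
      · have := hidx i hi h
        omega
  obtain rfl : q = j + 1 := by omega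
  set z := w (j + 1) with hz
  have hzP : z ∉ P := fun hm => hPQ' hm hQ.right_mem
  have hA0 : ∀ i ≤ s, w i ∈ ((Finset.range (s + 1)).image w ∪ P ∪ Q).erase z := fun i hi => by
    rw [Finset.mem_erase]
    refine ⟨fun h => ?_, ?_⟩
    · have := hw.eq_of (by omega) (by omega) h
      omega
    · exact Finset.mem_union_left _ (Finset.mem_union_left _ (Finset.mem_image_of_mem _ (by
        rw [Finset.mem_range]; omega)))
  obtain ⟨u, hu, y, hy, B, hBR, hB, hBA, hBB⟩ :=
    (h2 z hzS).exists_path (A := ((Finset.range (s + 1)).image w ∪ P ∪ Q).erase z)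
      (B := (Finset.Ico (j + 2) n).image w)
      (Finset.erase_subset_erase _ (Finset.union_subset (Finset.union_subset (fun x hx => by
        obtain ⟨i, hi, rfl⟩ := Finset.mem_image.1 hx
        rw [Finset.mem_range] at hi
        exact hwS i (by omega)) hPS) hQS))
      (fun x hx => by
        obtain ⟨i, hi, rfl⟩ := Finset.mem_image.1 hx
        rw [Finset.mem_Ico] at hi
        refine Finset.mem_erase.2 ⟨fun h => ?_, hwS i hi.2⟩
        have := hw.eq_of hi.2 (by omega) h
        omega)
      (by
        rw [Finset.disjoint_left]
        intro x hx hx'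
        obtain ⟨i, hi, rfl⟩ := Finset.mem_image.1 hx'
        rw [Finset.mem_Ico] at hi
        rw [Finset.mem_erase, Finset.union_assoc, Finset.mem_union] at hx
        rcases hx.2 with hx | hx
        · obtain ⟨k, hk, hki⟩ := Finset.mem_image.1 hx
          rw [Finset.mem_range] at hk
          have := hw.eq_of (by omega) hi.2 hki
          omega
        · have := hidx i hi.2 hx
          omega)
      ⟨w s, hA0 s le_rfl⟩
      ⟨w (j + 2), Finset.mem_image_of_mem _ (by rw [Finset.mem_Ico]; omega)⟩
  obtain ⟨q', hq', rfl⟩ := Finset.mem_image.1 hy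
  rw [Finset.mem_Ico] at hq'
  have hzB : z ∉ B := fun hm => (Finset.mem_erase.1 (hBR hm)).1 rfl
  have hBS : B ⊆ S := hBR.trans (Finset.erase_subset _ _)
  have hBP : ∀ x ∈ B, x ∈ P → x = u := fun x hx hxP => hBA x hx (Finset.mem_erase.2
    ⟨fun h => hzB (h ▸ hx), Finset.mem_union_left _ (Finset.mem_union_right _ hxP)⟩)
  have hBQ : ∀ x ∈ B, x ∈ Q → x = u := fun x hx hxQ => hBA x hx (Finset.mem_erase.2
    ⟨fun h => hzB (h ▸ hx), Finset.mem_union_right _ hxQ⟩)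
  have hBidx : ∀ i < n, w i ∈ B → w i = u ∨ s < i ∧ i < j + 1 ∨ i = q' := by
    intro i hi hiB
    rcases Nat.lt_or_ge s i with h1 | h1
    · rcases lt_trichotomy i (j + 1) with h3 | rfl | h3
      · exact Or.inr (Or.inl ⟨h1, h3⟩)
      · exact absurd hiB hzB
      · exact Or.inr (Or.inr (hw.eq_of hi hq'.2
          (hBB _ hiB (Finset.mem_image_of_mem _ (by rw [Finset.mem_Ico]; omega)))))
    · exact Or.inl (hBA _ hiB (hA0 i h1))
  rw [Finset.mem_erase, Finset.mem_union] at hu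
  by_cases huP : u ∈ P
  · obtain ⟨p, hpP, hp⟩ := hP.prefix_to huP
    refine ⟨q', a, σ', σ, Q, p ∪ B, by omega, hq'.2, has, by tauto, hQS,
      Finset.union_subset (hpP.trans hPS) hBS, ?_, hQ, hp.glue hB fun x hx hxB =>
        hBP x hxB (hpP hx), fun i hi hiP => ?_⟩
    · rw [Finset.disjoint_left]
      intro x hx hx'
      rcases Finset.mem_union.1 hx' with h | h
      · exact hPQ' (hpP h) hx
      · exact hPQ' (hBQ x h hx ▸ huP) hx
    · rw [Finset.mem_union, Finset.mem_union] at hiP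
      rcases hiP with h | h | h
      · have := hidxQ i hi h
        omega
      · have := hidxP i hi (hpP h)
        omega
      · rcases hBidx i hi h with h | h
        · have := hidxP i hi (h ▸ huP)
          omega
        · omega
  by_cases huQ : u ∈ Q
  · obtain ⟨p, r, hp, hr, rfl, hpr⟩ := hQ.split huQ
    have hzp : z ∉ p := fun hm => hu.1 (hpr z hm hr.right_mem).symm
    refine ⟨q', a, σ, σ', insert z P, p ∪ B, by omega, hq'.2, has, hσ,
      Finset.insert_subset hzS hPS,
      Finset.union_subset (Finset.subset_union_left.trans hQS) hBS, ?_, hP.snoc hadj hzP,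
      hp.glue hB fun x hx hxB => hBQ x hxB (Finset.mem_union_left _ hx), fun i hi hiP => ?_⟩
    · rw [Finset.disjoint_insert_left]
      refine ⟨by simp [hzp, hzB], ?_⟩
      rw [Finset.disjoint_left]
      intro x hx hx'
      rcases Finset.mem_union.1 hx' with h | h
      · exact hPQ' hx (Finset.mem_union_left _ h)
      · exact huP (hBP x h hx ▸ hx)
    · rw [Finset.mem_union, Finset.mem_union, Finset.mem_insert] at hiP
      rcases hiP with (h | h) | h | h
      · have := hw.eq_of hi (by omega) h
        omega
      · have := hidxP i hi h
        omega
      · have := hidxQ i hi (Finset.mem_union_left _ h)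
        omega
      · rcases hBidx i hi h with h | h
        · have := hidxQ i hi (h ▸ huQ)
          omega
        · omega
  obtain ⟨i₀, hi₀, rfl⟩ : ∃ i₀ ≤ s, w i₀ = u := by
    rcases hu.2 with h | h
    · rcases Finset.mem_union.1 h with h | h
      · obtain ⟨i, hi, rfl⟩ := Finset.mem_image.1 h
        rw [Finset.mem_range] at hi
        exact ⟨i, by omega, rfl⟩
      · exact absurd h huP
    · exact absurd h huQ
  have hi₀s : i₀ ≠ s := by
    rintro rfl
    rcases hσ with ⟨rfl, -⟩ | ⟨-, rfl⟩
    · exact huP hP.left_mem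
    · exact huQ hQ.left_mem
  have hBidx' : ∀ i < n, w i ∈ B → i = i₀ ∨ s < i ∧ i < j + 1 ∨ i = q' := fun i hi hiB => by
    rcases hBidx i hi hiB with h | h
    · exact Or.inl (hw.eq_of hi (by omega) h)
    · exact Or.inr h
  rcases hσ with ⟨rfl, rfl⟩ | ⟨rfl, rfl⟩
  · refine ⟨q', i₀, σ, i₀, insert z P, B, by omega, hq'.2, by omega, Or.inl ⟨rfl, rfl⟩,
      Finset.insert_subset hzS hPS, hBS, ?_, hP.snoc hadj hzP, hB, fun i hi hiP => ?_⟩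
    · rw [Finset.disjoint_insert_left]
      refine ⟨hzB, ?_⟩
      rw [Finset.disjoint_left]
      exact fun x hx hx' => huP (hBP x hx' hx ▸ hx)
    · rw [Finset.mem_union, Finset.mem_insert] at hiP
      rcases hiP with (h | h) | h
      · have := hw.eq_of hi (by omega) h
        omega
      · have := hidxP i hi h
        have : i ≠ σ' := by
          rintro rfl
          exact hPQ' h hQ.left_mem
        omega
      · have := hBidx' i hi h
        omega
  · refine ⟨q', i₀, σ', i₀, Q, B, by omega, hq'.2, by omega, Or.inl ⟨rfl, rfl⟩,
      hQS, hBS, ?_, hQ, hB, fun i hi hiP => ?_⟩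
    · rw [Finset.disjoint_left]
      exact fun x hx hx' => huQ (hBQ x hx' hx ▸ hx)
    · rw [Finset.mem_union] at hiP
      rcases hiP with h | h
      · have := hidxQ i hi h
        have : i ≠ σ := by
          rintro rfl
          exact hPQ' hP.left_mem h
        omega
      · have := hBidx' i hi h
        omega

lemma exists_isVine (h2 : ∀ z ∈ S, Linked G (S.erase z)) (hw : IsPathSeq G w n)
    (hwS : ∀ i < n, w i ∈ S) (hs : 0 < s) (hsj : s ≤ j) (hjn : j + 1 < n) : IsVine G S w n s j := by
  induction j, hsj using Nat.le_induction with
  | base => exact isVine_base h2 hw hwS hs hjn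
  | succ j hsj ih => exact (ih (by omega)).succ h2 hw hwS hsj (by omega)

lemma eq_of_bool_ne {a b c : Bool} (h : a ≠ b) (h' : b ≠ c) : a = c := by
  cases a <;> cases b <;> cases c <;> simp at *

/-- Suppose all neighbours of the first vertex of a path precede all neighbours of the last one on
the path. Then in a 2-connected bipartite graph there is a long cycle. -/
lemma exists_long_cycle_of_vine (hcol : ∀ u v, G.Adj u v → col u ≠ col v)
    (h2 : ∀ z ∈ S, Linked G (S.erase z)) (hw : IsPathSeq G w n) (hwS : ∀ i < n, w i ∈ S)
    (hne : col (w 0) ≠ col (w (n - 1))) (hs : G.Adj (w 0) (w s))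
    (hs' : G.Adj (w (n - 1)) (w s')) (hss : s ≤ s') (hsn : s' < n)
    (hN : ∀ u ∈ S, G.Adj (w 0) u → ∃ i ≤ s, w i = u)
    (hN' : ∀ u ∈ S, G.Adj (w (n - 1)) u → ∃ i, s' ≤ i ∧ i < n ∧ w i = u) :
    ∃ C ⊆ S, CycleOn G C ∧ 2 * (degreeIn G S (w 0) + degreeIn G S (w (n - 1))) ≤ C.card + 2 := by
  classical
  have hs0 : 0 < s := Nat.pos_of_ne_zero fun h => hs.ne (by rw [h])
  have hsn' : s' ≠ n - 1 := fun h => hs'.ne (by rw [h])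
  obtain ⟨q, a, σ, σ', P, Q, hjq, hqn, has, hσ, hPS, hQS, hPQ, hP, hQ, hidx⟩ :=
    exists_isVine h2 hw hwS hs0 hss (by omega)
  have hPQ' := Finset.disjoint_left.1 hPQ
  -- the first neighbour of `w 0` after `w a`
  have hex : ∃ p, a < p ∧ G.Adj (w 0) (w p) := ⟨s, has, hs⟩
  obtain ⟨hp1, hp2⟩ := Nat.find_spec hex
  have hp3 : Nat.find hex ≤ s := Nat.find_min' hex ⟨has, hs⟩
  have hp4 : ∀ i, a < i → i < Nat.find hex → ¬ G.Adj (w 0) (w i) := fun i h1 h2 h3 =>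
    Nat.find_min hex h2 ⟨h1, h3⟩
  set p := Nat.find hex
  -- the last neighbour of the end before `w q`
  obtain ⟨p', hp'1, hp'2⟩ := Finset.exists_max_image
    ((Finset.range q).filter fun i => G.Adj (w (n - 1)) (w i)) id
    ⟨s', by rw [Finset.mem_filter, Finset.mem_range]; exact ⟨hjq, hs'⟩⟩
  rw [Finset.mem_filter, Finset.mem_range] at hp'1
  have hp'3 : ∀ i < q, G.Adj (w (n - 1)) (w i) → i ≤ p' := fun i h1 h2 =>
    hp'2 i (by rw [Finset.mem_filter, Finset.mem_range]; exact ⟨h1, h2⟩)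
  have hsp' := hp'3 s' hjq hs'
  have hdisj : ∀ i j k l, j < k → k ≤ l → l < n → Disjoint ((Finset.Icc i j).image w)
      ((Finset.Icc k l).image w) := fun i j k l hjk hkl hl => by
    refine hw.disjoint_image (fun m hm => ?_) (fun m hm => ?_) ?_
    · rw [Finset.mem_Icc] at hm; omega
    · rw [Finset.mem_Icc] at hm; omega
    · rw [Finset.disjoint_left]
      intro m hm hm'
      rw [Finset.mem_Icc] at hm hm'
      omega
  have hLA := (hw.segment (Nat.zero_le a) (by omega)).symm.append
    (hw.segment (i := p) (j := s) hp3 (by omega)) hp2 (hdisj _ _ _ _ hp1 hp3 (by omega))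
  have hLB := (hw.segment (i := s') (j := p') hsp' (by omega)).append
    (hw.segment (i := q) (j := n - 1) (by omega) (by omega)).symm hp'1.2.symm
    (hdisj _ _ _ _ hp'1.1 (by omega) (by omega))
  rw [← Finset.image_union] at hLA hLB
  set A := Finset.Icc 0 a ∪ Finset.Icc p s with hA
  set B := Finset.Icc s' p' ∪ Finset.Icc q (n - 1) with hB
  have hAi : ∀ i ∈ A, i ≤ a ∨ p ≤ i ∧ i ≤ s := fun i hi => by
    simp only [hA, Finset.mem_union, Finset.mem_Icc] at hi
    omega
  have hBi : ∀ i ∈ B, i < n ∧ (s' ≤ i ∧ i ≤ p' ∨ q ≤ i) := fun i hi => by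
    simp only [hB, Finset.mem_union, Finset.mem_Icc] at hi
    omega
  have g1 := hP.glue hLB (fun x hx hx' => by
    obtain ⟨i, hi, rfl⟩ := Finset.mem_image.1 hx'
    have h1 := hBi i hi
    have h2 := hidx i h1.1 (Finset.mem_union_left _ hx)
    have h3 : i ≠ q := by rintro rfl; exact hPQ' hx hQ.right_mem
    congr 1
    omega)
  have g2 := g1.glue hQ.symm (fun x hx hx' => by
    rcases Finset.mem_union.1 hx with hx | hx
    · exact absurd hx' (hPQ' hx)
    · obtain ⟨i, hi, rfl⟩ := Finset.mem_image.1 hx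
      have h1 := hBi i hi
      have h2 := hidx i h1.1 (Finset.mem_union_right _ hx')
      have h3 : i ≠ s' := by rintro rfl; exact hPQ' hP.right_mem hx'
      congr 1
      omega)
  have hLA' : PathOn G (w σ') (w σ) (A.image w) := by
    rcases hσ with ⟨rfl, rfl⟩ | ⟨rfl, rfl⟩
    · exact hLA
    · exact hLA.symm
  have hσne : w σ ≠ w σ' := fun h => by
    have := hw.eq_of (by omega) (by omega) h
    omega
  have hmeet : ∀ x ∈ P ∪ B.image w ∪ Q, x ∈ A.image w → x = w σ ∨ x = w σ' := by
    intro x hx hx'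
    obtain ⟨i, hi, rfl⟩ := Finset.mem_image.1 hx'
    have h1 := hAi i hi
    have h2 : i = s ∨ i = a := by
      have h3 : w i ∈ P ∪ Q ∨ w i ∈ B.image w := by
        simp only [Finset.mem_union] at hx ⊢
        tauto
      rcases h3 with h3 | h3
      · have := hidx i (by omega) h3
        omega
      · obtain ⟨k, hk, hki⟩ := Finset.mem_image.1 h3
        have h4 := hBi k hk
        have := hw.eq_of h4.1 (by omega) hki
        omega
    rcases hσ with ⟨rfl, rfl⟩ | ⟨rfl, rfl⟩ <;> rcases h2 with rfl | rfl <;> simp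
  set C := P ∪ B.image w ∪ Q ∪ A.image w with hC
  have himage : ∀ D : Finset ℕ, (∀ i ∈ D, i < n) → D.image w ⊆ S := fun D hD x hx => by
    obtain ⟨i, hi, rfl⟩ := Finset.mem_image.1 hx
    exact hwS i (hD i hi)
  have hCS : C ⊆ S := Finset.union_subset (Finset.union_subset (Finset.union_subset hPS
    (himage B fun i hi => (hBi i hi).1)) hQS) (himage A fun i hi => by have := hAi i hi; omega)
  set A' := (Finset.range s).filter fun i => G.Adj (w 0) (w (i + 1)) with hA'
  set B' := (Finset.range n).filter fun i => G.Adj (w (n - 1)) (w i) with hB'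
  have hdA : degreeIn G S (w 0) ≤ A'.card := by
    refine (Finset.card_le_card (t := A'.image fun i => w (i + 1)) fun u hu => ?_).trans
      Finset.card_image_le
    rw [Finset.mem_filter] at hu
    obtain ⟨i, hi, rfl⟩ := hN u hu.1 hu.2
    have hi0 : i ≠ 0 := by
      rintro rfl
      exact hu.2.ne rfl
    refine Finset.mem_image.2 ⟨i - 1, ?_, by rw [Nat.sub_add_cancel (by omega)]⟩
    rw [Finset.mem_filter, Finset.mem_range, Nat.sub_add_cancel (by omega)]
    exact ⟨by omega, hu.2⟩
  have hdB : degreeIn G S (w (n - 1)) ≤ B'.card := by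
    refine (Finset.card_le_card (t := B'.image w) fun u hu => ?_).trans Finset.card_image_le
    rw [Finset.mem_filter] at hu
    obtain ⟨i, hi, hin, rfl⟩ := hN' u hu.1 hu.2
    exact Finset.mem_image_of_mem _ (Finset.mem_filter.2 ⟨Finset.mem_range.2 hin, hu.2⟩)
  have hB's : ∀ i ∈ B', s' ≤ i ∧ i < n := fun i hi => by
    rw [Finset.mem_filter, Finset.mem_range] at hi
    obtain ⟨k, hk, hkn, hki⟩ := hN' _ (hwS i hi.1) hi.2
    have := hw.eq_of hkn hi.1 hki
    omega
  have hdisj' : Disjoint (A'.erase (p - 1)) B' := by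
    rw [Finset.disjoint_left]
    intro i hi hi'
    have h1 := hB's i hi'
    simp only [hA', Finset.mem_erase, Finset.mem_filter, Finset.mem_range] at hi
    omega
  have hsub : (A'.erase (p - 1) ∪ B').image w ⊆ C.filter (col · = col (w 0)) := by
    intro x hx
    obtain ⟨i, hi, rfl⟩ := Finset.mem_image.1 hx
    rw [Finset.mem_filter]
    rcases Finset.mem_union.1 hi with hi | hi
    · simp only [hA', Finset.mem_erase, Finset.mem_filter, Finset.mem_range] at hi
      have h1 := hw.parity_ne hcol (by omega) (by omega) hi.2.2
      refine ⟨Finset.mem_union_right _ (Finset.mem_image_of_mem _ ?_),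
        (hw.col_eq_iff hcol (by omega) (by omega)).2 (by omega)⟩
      rw [hA, Finset.mem_union, Finset.mem_Icc, Finset.mem_Icc]
      have : ¬ (a < i + 1 ∧ i + 1 < p) := fun h => hp4 _ h.1 h.2 hi.2.2
      omega
    · have h1 := hB's i hi
      simp only [hB', Finset.mem_filter, Finset.mem_range] at hi
      have h2 := hcol _ _ hi.2
      refine ⟨Finset.mem_union_left _ (Finset.mem_union_left _ (Finset.mem_union_right _
        (Finset.mem_image_of_mem _ ?_))), ?_⟩
      · rw [hB, Finset.mem_union, Finset.mem_Icc, Finset.mem_Icc]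
        have := fun h => hp'3 i h hi.2
        omega
      · exact eq_of_bool_ne h2.symm hne.symm
  have hcount := Finset.card_le_card hsub
  rw [hw.card_image (fun i hi => by
    rcases Finset.mem_union.1 hi with hi | hi
    · simp only [hA', Finset.mem_erase, Finset.mem_filter, Finset.mem_range] at hi
      omega
    · exact (hB's i hi).2), Finset.card_union_of_disjoint hdisj'] at hcount
  have hpA : p - 1 ∈ A' := by
    rw [Finset.mem_filter, Finset.mem_range, Nat.sub_add_cancel (by omega)]
    exact ⟨by omega, hp2⟩
  have h1 := Finset.card_erase_add_one hpA
  have hcard3 : 3 ≤ C.card := by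
    have hA1 : ∀ i ∈ A, w i ∈ C := fun i hi =>
      Finset.mem_union_right _ (Finset.mem_image_of_mem _ hi)
    have hq : w q ∈ C := Finset.mem_union_left _ (Finset.mem_union_right _ hQ.right_mem)
    have h4 : ({a, s, q} : Finset ℕ).image w ⊆ C := fun x hx => by
      obtain ⟨i, hi, rfl⟩ := Finset.mem_image.1 hx
      rw [Finset.mem_insert, Finset.mem_insert, Finset.mem_singleton] at hi
      rcases hi with rfl | rfl | rfl
      · exact hA1 _ (Finset.mem_union_left _ (Finset.mem_Icc.2 ⟨Nat.zero_le _, le_rfl⟩))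
      · exact hA1 _ (Finset.mem_union_right _ (Finset.mem_Icc.2 ⟨hp3, le_rfl⟩))
      · exact hq
    have h5 := Finset.card_le_card h4
    rwa [hw.card_image (fun i hi => by
      rw [Finset.mem_insert, Finset.mem_insert, Finset.mem_singleton] at hi
      omega), Finset.card_eq_three.2 ⟨a, s, q, by omega, by omega, by omega, rfl⟩] at h5
  have hcyc := g2.glue_cycle hLA' hmeet hσne hcard3
  have h3 : 2 * (C.filter (col · = col (w 0))).card = C.card :=
    hcyc.colourCount_eq hcol (col (w 0))
  exact ⟨C, hCS, hcyc, by omega⟩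

end Vine

section LongCycles

variable {V : Type*} [DecidableEq V] {G : SimpleGraph V} [DecidableRel G.Adj] {col : V → Bool}

lemma PathOn.exists_isPathSeq_glue {a b c : V} {s s' : Finset V} (h : PathOn G a c s)
    (h' : PathOn G c b s') (hd : ∀ v ∈ s, v ∈ s' → v = c) :
    ∃ w n k, IsPathSeq G w n ∧ w 0 = a ∧ w (n - 1) = b ∧ k < n ∧ (∀ v ∈ s, ∃ i ≤ k, w i = v) ∧
      (∀ v ∈ s', ∃ i, k ≤ i ∧ i < n ∧ w i = v) ∧ ∀ i < n, w i ∈ s ∪ s' := by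
  obtain ⟨w, hw, hw0, hwl, hws⟩ := h.exists_isPathSeq
  obtain ⟨u, hu, hu0, hul, hus⟩ := h'.exists_isPathSeq
  have hc := Finset.card_pos.2 ⟨a, h.left_mem⟩
  have hc' := Finset.card_pos.2 ⟨c, h'.left_mem⟩
  have hwm : ∀ i < s.card, w i ∈ s := fun i hi =>
    hws.subset (Finset.mem_image_of_mem _ (Finset.mem_range.2 hi))
  have hum : ∀ i < s'.card, u i ∈ s' := fun i hi =>
    hus.subset (Finset.mem_image_of_mem _ (Finset.mem_range.2 hi))
  generalize s.card = m at *
  generalize s'.card = l at *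
  obtain ⟨f, hf⟩ : ∃ f : ℕ → V, f = fun i => if i < m then w i else u (i - (m - 1)) := ⟨_, rfl⟩
  have e1 : ∀ i < m, f i = w i := fun i hi => by rw [hf]; exact if_pos hi
  have e2 : ∀ i, m - 1 ≤ i → f i = u (i - (m - 1)) := fun i hi => by
    by_cases him : i < m
    · obtain rfl : i = m - 1 := by omega
      rw [e1 _ him, hwl, Nat.sub_self, hu0]
    · rw [hf]; exact if_neg him
  refine ⟨f, m + l - 1, m - 1, ⟨fun i hi => ?_, fun i j hij hj hfij => ?_⟩, ?_, ?_, by omega,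
    fun v hv => ?_, fun v hv => ?_, fun i hi => ?_⟩
  · rcases Nat.lt_or_ge (i + 1) m with h1 | h1
    · rw [e1 _ h1, e1 _ (by omega)]
      exact hw.adj i h1
    · rw [e2 (i + 1) (by omega), e2 i (by omega), show i + 1 - (m - 1) = i - (m - 1) + 1 by omega]
      exact hu.adj _ (by omega)
  · rcases Nat.lt_or_ge j m with h1 | h1
    · rw [e1 _ h1, e1 _ (by omega)] at hfij
      exact hw.ne i j hij h1 hfij
    · rcases Nat.lt_or_ge i m with h2 | h2
      · rw [e1 _ h2, e2 _ (by omega)] at hfij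
        have h3 := hd _ (hwm i h2) (hfij ▸ hum _ (by omega))
        have := hu.eq_of (by omega) hc' ((hfij.symm.trans h3).trans hu0.symm)
        omega
      · rw [e2 i (by omega), e2 j (by omega)] at hfij
        exact hu.ne _ _ (by omega) (by omega) hfij
  · rw [e1 _ hc, hw0]
  · rw [e2 _ (by omega), show m + l - 1 - 1 - (m - 1) = l - 1 by omega, hul]
  · rw [← hws] at hv
    obtain ⟨i, hi, rfl⟩ := Finset.mem_image.1 hv
    rw [Finset.mem_range] at hi
    exact ⟨i, by omega, e1 i hi⟩
  · rw [← hus] at hv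
    obtain ⟨i, hi, rfl⟩ := Finset.mem_image.1 hv
    rw [Finset.mem_range] at hi
    exact ⟨i + (m - 1), by omega, by omega, by
      rw [e2 _ (by omega), show i + (m - 1) - (m - 1) = i by omega]⟩
  · rcases Nat.lt_or_ge i m with h1 | h1
    · rw [e1 _ h1]
      exact Finset.mem_union_left _ (hwm i h1)
    · rw [e2 _ (by omega)]
      exact Finset.mem_union_right _ (hum _ (by omega))

variable {S : Finset V} {w : ℕ → V} {n : ℕ}

lemma exists_long_cycle_of_separated (hcol : ∀ u v, G.Adj u v → col u ≠ col v)
    (h2 : ∀ z ∈ S, Linked G (S.erase z)) (hpos : ∀ v ∈ S, ∃ u ∈ S, G.Adj v u)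
    (hw : IsPathSeq G w n) (hwS : ∀ i < n, w i ∈ S) (hne : col (w 0) ≠ col (w (n - 1)))
    (hN : ∀ u ∈ S, G.Adj (w 0) u → ∃ i < n, w i = u)
    (hN' : ∀ u ∈ S, G.Adj (w (n - 1)) u → ∃ i < n, w i = u)
    (hsep : ∀ i < n, ∀ j < n, G.Adj (w 0) (w i) → G.Adj (w (n - 1)) (w j) → i ≤ j) :
    ∃ C ⊆ S, CycleOn G C ∧ 2 * (degreeIn G S (w 0) + degreeIn G S (w (n - 1))) ≤ C.card + 2 := by
  have hn : 0 < n := Nat.pos_of_ne_zero fun h => hne (by rw [h])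
  obtain ⟨u, hu, hwu⟩ := hpos _ (hwS 0 hn)
  obtain ⟨i, hi, rfl⟩ := hN u hu hwu
  obtain ⟨u', hu', hwu'⟩ := hpos _ (hwS (n - 1) (by omega))
  obtain ⟨j, hj, rfl⟩ := hN' u' hu' hwu'
  obtain ⟨s, hs, hsmax⟩ := Finset.exists_max_image
    ((Finset.range n).filter fun i => G.Adj (w 0) (w i)) id
    ⟨i, Finset.mem_filter.2 ⟨Finset.mem_range.2 hi, hwu⟩⟩
  obtain ⟨s', hs', hsmin⟩ := Finset.exists_min_image
    ((Finset.range n).filter fun i => G.Adj (w (n - 1)) (w i)) id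
    ⟨j, Finset.mem_filter.2 ⟨Finset.mem_range.2 hj, hwu'⟩⟩
  rw [Finset.mem_filter, Finset.mem_range] at hs hs'
  refine exists_long_cycle_of_vine hcol h2 hw hwS hne hs.2 hs'.2
    (hsep _ hs.1 _ hs'.1 hs.2 hs'.2) hs'.1 (fun u hu h => ?_) fun u hu h => ?_
  · obtain ⟨k, hk, rfl⟩ := hN u hu h
    exact ⟨k, hsmax k (Finset.mem_filter.2 ⟨Finset.mem_range.2 hk, h⟩), rfl⟩
  · obtain ⟨k, hk, rfl⟩ := hN' u hu h
    exact ⟨k, hsmin k (Finset.mem_filter.2 ⟨Finset.mem_range.2 hk, h⟩), hk, rfl⟩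

lemma exists_long_cycle_of_overlap (hcol : ∀ u v, G.Adj u v → col u ≠ col v)
    (hw : IsPathSeq G w n) (hwS : ∀ i < n, w i ∈ S) (hne : col (w 0) ≠ col (w (n - 1)))
    (hN : ∀ u ∈ S, G.Adj (w 0) u → ∃ i < n, w i = u)
    (hN' : ∀ u ∈ S, G.Adj (w (n - 1)) u → ∃ i < n, w i = u)
    (hcross : ∀ i, i + 1 < n → G.Adj (w 0) (w (i + 1)) → ¬ G.Adj (w (n - 1)) (w i))
    {i₀ j₀ : ℕ} (hij₀ : i₀ < j₀) (hj₀ : j₀ < n) (hi₀ : G.Adj (w (n - 1)) (w i₀))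
    (hj₀' : G.Adj (w 0) (w j₀)) :
    ∃ C ⊆ S, CycleOn G C ∧ 2 * (degreeIn G S (w 0) + degreeIn G S (w (n - 1))) ≤ C.card + 2 := by
  classical
  obtain ⟨⟨i, j⟩, hp, hmin⟩ := Finset.exists_min_image
    (((Finset.range n) ×ˢ (Finset.range n)).filter fun p : ℕ × ℕ =>
      p.1 < p.2 ∧ G.Adj (w (n - 1)) (w p.1) ∧ G.Adj (w 0) (w p.2)) (fun p => p.2 - p.1)
    ⟨(i₀, j₀), by
      simp only [Finset.mem_filter, Finset.mem_product, Finset.mem_range]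
      exact ⟨⟨by omega, hj₀⟩, hij₀, hi₀, hj₀'⟩⟩
  simp only [Finset.mem_filter, Finset.mem_product, Finset.mem_range] at hp
  obtain ⟨⟨hin, hjn⟩, hij, hi, hj⟩ := hp
  have hmin' : ∀ k l, k < l → l < n → G.Adj (w (n - 1)) (w k) → G.Adj (w 0) (w l) →
      j - i ≤ l - k := fun k l hkl hl h1 h2 => hmin (k, l) (by
    simp only [Finset.mem_filter, Finset.mem_product, Finset.mem_range]
    exact ⟨⟨by omega, hl⟩, hkl, h1, h2⟩)
  have hi0 : i ≠ 0 := by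
    rintro rfl
    exact hcross 0 (by omega) (hw.adj 0 (by omega)) hi
  have p1 := hw.segment (Nat.zero_le i) hin
  have p2 := (hw.segment (i := j) (j := n - 1) (by omega) (by omega)).symm
  have hlt : ∀ k ∈ Finset.Icc 0 i ∪ Finset.Icc j (n - 1), k < n := fun k hk => by
    rw [Finset.mem_union, Finset.mem_Icc, Finset.mem_Icc] at hk
    omega
  have hd : Disjoint (Finset.Icc 0 i) (Finset.Icc j (n - 1)) := by
    rw [Finset.disjoint_left]
    intro k hk hk'
    rw [Finset.mem_Icc] at hk hk'
    omega
  have hcyc := p1.close p2 hi.symm hj.symm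
    (hw.disjoint_image (fun k hk => hlt k (Finset.mem_union_left _ hk))
      (fun k hk => hlt k (Finset.mem_union_right _ hk)) hd)
    (by
      rw [hw.card_image fun k hk => hlt k (Finset.mem_union_left _ hk),
        hw.card_image fun k hk => hlt k (Finset.mem_union_right _ hk), Nat.card_Icc, Nat.card_Icc]
      omega)
  rw [← Finset.image_union] at hcyc
  set C := (Finset.Icc 0 i ∪ Finset.Icc j (n - 1)).image w with hC
  have hCS : C ⊆ S := fun x hx => by
    obtain ⟨k, hk, rfl⟩ := Finset.mem_image.1 hx
    exact hwS k (hlt k hk)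
  set A' := (Finset.range (n - 1)).filter fun i => G.Adj (w 0) (w (i + 1)) with hA'
  set B' := (Finset.range n).filter fun i => G.Adj (w (n - 1)) (w i) with hB'
  have hdA : degreeIn G S (w 0) ≤ A'.card := by
    refine (Finset.card_le_card (t := A'.image fun i => w (i + 1)) fun u hu => ?_).trans
      Finset.card_image_le
    rw [Finset.mem_filter] at hu
    obtain ⟨k, hk, rfl⟩ := hN u hu.1 hu.2
    have hi0 : k ≠ 0 := by
      rintro rfl
      exact hu.2.ne rfl
    refine Finset.mem_image.2 ⟨k - 1, ?_, by rw [Nat.sub_add_cancel (by omega)]⟩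
    rw [Finset.mem_filter, Finset.mem_range, Nat.sub_add_cancel (by omega)]
    exact ⟨by omega, hu.2⟩
  have hdB : degreeIn G S (w (n - 1)) ≤ B'.card := by
    refine (Finset.card_le_card (t := B'.image w) fun u hu => ?_).trans Finset.card_image_le
    rw [Finset.mem_filter] at hu
    obtain ⟨i, hin, rfl⟩ := hN' u hu.1 hu.2
    exact Finset.mem_image_of_mem _ (Finset.mem_filter.2 ⟨Finset.mem_range.2 hin, hu.2⟩)
  have hdisj' : Disjoint (A'.erase (j - 1)) B' := by
    rw [Finset.disjoint_left]
    intro k hk hk'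
    simp only [hA', Finset.mem_erase, Finset.mem_filter, Finset.mem_range] at hk
    exact hcross k (by omega) hk.2.2 (Finset.mem_filter.1 hk').2
  have hsub : (A'.erase (j - 1) ∪ B').image w ⊆ C.filter (col · = col (w 0)) := by
    intro x hx
    obtain ⟨k, hk, rfl⟩ := Finset.mem_image.1 hx
    rw [Finset.mem_filter]
    rcases Finset.mem_union.1 hk with hk | hk
    · simp only [hA', Finset.mem_erase, Finset.mem_filter, Finset.mem_range] at hk
      have h1 := hw.parity_ne hcol (by omega) (by omega) hk.2.2
      refine ⟨Finset.mem_image_of_mem _ ?_,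
        (hw.col_eq_iff hcol (by omega) (by omega)).2 (by omega)⟩
      rw [Finset.mem_union, Finset.mem_Icc, Finset.mem_Icc]
      have := fun h => hmin' i (k + 1) h (by omega) hi hk.2.2
      omega
    · simp only [hB', Finset.mem_filter, Finset.mem_range] at hk
      refine ⟨Finset.mem_image_of_mem _ ?_, eq_of_bool_ne (hcol _ _ hk.2).symm hne.symm⟩
      rw [Finset.mem_union, Finset.mem_Icc, Finset.mem_Icc]
      have := fun h => hmin' k j h hjn hk.2 hj
      omega
  have hcount := Finset.card_le_card hsub
  rw [hw.card_image (fun i hi => by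
    rcases Finset.mem_union.1 hi with hi | hi
    · simp only [hA', Finset.mem_erase, Finset.mem_filter, Finset.mem_range] at hi
      omega
    · exact Finset.mem_range.1 (Finset.mem_filter.1 hi).1),
    Finset.card_union_of_disjoint hdisj'] at hcount
  have h1 := Finset.pred_card_le_card_erase (s := A') (a := j - 1)
  have h3 : 2 * (C.filter (col · = col (w 0))).card = C.card :=
    hcyc.colourCount_eq hcol (col (w 0))
  exact ⟨C, hCS, hcyc, by omega⟩

/-- Pósa's rotation argument: a path whose ends have no neighbours outside, and which does not
close up, gives rise to a long cycle. -/
lemma exists_long_cycle_of_path (hcol : ∀ u v, G.Adj u v → col u ≠ col v)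
    (h2 : ∀ z ∈ S, Linked G (S.erase z)) (hpos : ∀ v ∈ S, ∃ u ∈ S, G.Adj v u) {a b : V}
    {l : Finset V} (hl : PathOn G a b l) (hlS : l ⊆ S) (hab : col a ≠ col b)
    (ha : ∀ u ∈ S, G.Adj a u → u ∈ l) (hb : ∀ u ∈ S, G.Adj b u → u ∈ l) (hr : ¬ RingOn G l) :
    ∃ C ⊆ S, CycleOn G C ∧ 2 * (degreeIn G S a + degreeIn G S b) ≤ C.card + 2 := by
  obtain ⟨w, hw, rfl, rfl, hwl⟩ := hl.exists_isPathSeq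
  have hidx : ∀ u ∈ l, ∃ i < l.card, w i = u := fun u hu => by
    rw [← hwl] at hu
    obtain ⟨i, hi, rfl⟩ := Finset.mem_image.1 hu
    exact ⟨i, Finset.mem_range.1 hi, rfl⟩
  have hwS : ∀ i < l.card, w i ∈ S := fun i hi =>
    hlS (hwl.subset (Finset.mem_image_of_mem _ (Finset.mem_range.2 hi)))
  have hN := fun u hu h => hidx u (ha u hu h)
  have hN' := fun u hu h => hidx u (hb u hu h)
  by_cases hsep : ∀ i < l.card, ∀ j < l.card, G.Adj (w 0) (w i) →
      G.Adj (w (l.card - 1)) (w j) → i ≤ j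
  · exact exists_long_cycle_of_separated hcol h2 hpos hw hwS hab hN hN' hsep
  · push Not at hsep
    obtain ⟨j, hj, i, -, hj', hi', hij⟩ := hsep
    exact exists_long_cycle_of_overlap hcol hw hwS hab hN hN'
      (fun i hi h h' => hr (hwl ▸ hw.ringOn hi h h')) hij hj hi' hj'

/-- `A` is a set with few neighbours in `S`, all of them in `B`, and from each vertex of `B` a path
runs to a vertex of `A` with no neighbours outside the path. -/
structure IsHallEnd (G : SimpleGraph V) (S A B : Finset V) : Prop where
  card_lt : B.card < A.card
  mem : ∀ a ∈ A, ∀ u ∈ S, G.Adj a u → u ∈ B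
  subset : B ⊆ S
  exists_adj : ∀ b ∈ B, ∃ a ∈ A, G.Adj a b
  exists_path : ∀ b ∈ B, ∃ a ∈ A, ∃ l ⊆ A ∪ B, PathOn G b a l ∧ ∀ u ∈ S, G.Adj a u → u ∈ l

lemma exists_isHallEnd (hcol : ∀ u v, G.Adj u v → col u ≠ col v) {A₀ : Finset V} {d : Bool}
    (hA₀ : A₀ ⊆ S.filter (col · = d))
    (h : (A₀.biUnion fun x => S.filter (G.Adj x)).card < A₀.card) :
    ∃ A ⊆ A₀, ∃ B, IsHallEnd G S A B := by
  classical
  set N : Finset V → Finset V := fun A => A.biUnion fun x => S.filter (G.Adj x) with hN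
  have hmemN : ∀ A u, u ∈ N A ↔ u ∈ S ∧ ∃ a ∈ A, G.Adj a u := fun A u => by
    simp only [hN, Finset.mem_biUnion, Finset.mem_filter]
    tauto
  obtain ⟨A, hA, hmin⟩ := Finset.exists_min_image
    (A₀.powerset.filter fun A => (N A).card < A.card) Finset.card
    ⟨A₀, Finset.mem_filter.2 ⟨Finset.mem_powerset.2 subset_rfl, h⟩⟩
  rw [Finset.mem_filter, Finset.mem_powerset] at hA
  obtain ⟨hAA, hlt⟩ := hA
  have hcA : ∀ a ∈ A, col a = d := fun a ha => (Finset.mem_filter.1 (hA₀ (hAA ha))).2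
  have hcB : ∀ u ∈ N A, u ∉ A := fun u hu huA => by
    obtain ⟨-, a, ha, hau⟩ := (hmemN _ _).1 hu
    exact hcol _ _ hau ((hcA a ha).trans (hcA u huA).symm)
  obtain ⟨ψ, hψ, hψN⟩ := exists_injOn_of_hall (N A) (fun u => A.filter (G.Adj u)) fun B' hB' => by
    by_contra hcon
    push Not at hcon
    set D := B'.biUnion fun u => A.filter (G.Adj u) with hD
    have hDA : D ⊆ A := Finset.biUnion_subset.2 fun u _ => Finset.filter_subset _ _
    have hNsub : N (A \ D) ⊆ N A \ B' := fun u hu => by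
      obtain ⟨huS, a, ha, hau⟩ := (hmemN _ _).1 hu
      rw [Finset.mem_sdiff] at ha
      refine Finset.mem_sdiff.2 ⟨(hmemN _ _).2 ⟨huS, a, ha.1, hau⟩, fun huB => ha.2 ?_⟩
      exact Finset.mem_biUnion.2 ⟨u, huB, Finset.mem_filter.2 ⟨ha.1, hau.symm⟩⟩
    have h1 := Finset.card_le_card hNsub
    rw [Finset.card_sdiff_of_subset hB'] at h1
    have h2 := Finset.card_sdiff_of_subset hDA
    have h3 := Finset.card_le_card hB'
    have h4 := hmin (A \ D) (by
      rw [Finset.mem_filter, Finset.mem_powerset]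
      exact ⟨Finset.sdiff_subset.trans hAA, by omega⟩)
    have h5 : 0 < D.card := by
      obtain ⟨u, hu⟩ := Finset.card_pos.1 (lt_of_le_of_lt (Nat.zero_le _) hcon)
      obtain ⟨-, a, ha, hau⟩ := (hmemN _ _).1 (hB' hu)
      exact Finset.card_pos.2 ⟨a, Finset.mem_biUnion.2 ⟨u, hu, Finset.mem_filter.2 ⟨ha, hau.symm⟩⟩⟩
    have h6 := Finset.card_le_card hDA
    omega
  have hψA : ∀ u ∈ N A, ψ u ∈ A := fun u hu => (Finset.mem_filter.1 (hψN u hu)).1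
  have hψadj : ∀ u ∈ N A, G.Adj u (ψ u) := fun u hu => (Finset.mem_filter.1 (hψN u hu)).2
  have hψne : ∀ u ∈ N A, ∀ v ∈ N A, ψ u ≠ v := fun u hu v hv h => hcB v hv (h ▸ hψA u hu)
  refine ⟨A, hAA, N A, hlt, fun a ha u hu hau => (hmemN _ _).2 ⟨hu, a, ha, hau⟩,
    fun u hu => ((hmemN _ _).1 hu).1, fun u hu => ((hmemN _ _).1 hu).2, fun b hb => ?_⟩
  obtain ⟨l, hl, hmax⟩ := Finset.exists_max_image
    ((A ∪ N A).powerset.filter fun l => (∃ a ∈ A, PathOn G b a l) ∧ ∀ y ∈ N A, y ∉ l → ψ y ∉ l)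
    Finset.card ⟨{b, ψ b}, by
      rw [Finset.mem_filter, Finset.mem_powerset]
      refine ⟨?_, ⟨ψ b, hψA b hb, .cons (hψadj b hb) ?_ (.single _)⟩, fun y hy hyl => ?_⟩
      · rw [Finset.insert_subset_iff, Finset.singleton_subset_iff]
        exact ⟨Finset.mem_union_right _ hb, Finset.mem_union_left _ (hψA b hb)⟩
      · rw [Finset.mem_singleton]
        exact (hψadj b hb).ne
      · rw [Finset.mem_insert, Finset.mem_singleton, not_or] at hyl ⊢
        exact ⟨hψne y hy b hb, fun h => hyl.1 (hψ hy hb h)⟩⟩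
  rw [Finset.mem_filter, Finset.mem_powerset] at hl
  obtain ⟨hlA, ⟨a, ha, hp⟩, hψl⟩ := hl
  refine ⟨a, ha, l, hlA, hp, fun u hu hau => by_contra fun hul => ?_⟩
  have huN : u ∈ N A := (hmemN _ _).2 ⟨hu, a, ha, hau⟩
  have hn : ψ u ∉ insert u l := by
    rw [Finset.mem_insert, not_or]
    exact ⟨hψne u huN u huN, hψl u huN hul⟩
  have h1 := hmax (insert (ψ u) (insert u l)) (by
    rw [Finset.mem_filter, Finset.mem_powerset]
    refine ⟨Finset.insert_subset (Finset.mem_union_left _ (hψA u huN))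
      (Finset.insert_subset (Finset.mem_union_right _ huN) hlA),
      ⟨ψ u, hψA u huN, (hp.snoc hau hul).snoc (hψadj u huN) hn⟩, fun y hy hyl => ?_⟩
    simp only [Finset.mem_insert, not_or] at hyl ⊢
    exact ⟨fun h => hyl.2.1 (hψ hy huN h), hψne y hy u huN, hψl y hy hyl.2.2⟩)
  rw [Finset.card_insert_of_notMem hn, Finset.card_insert_of_notMem hul] at h1
  omega

lemma PathOn.exists_adj {a b : V} {s : Finset V} (h : PathOn G a b s) (hab : a ≠ b) :
    ∃ c ∈ s, G.Adj a c := by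
  cases h with
  | single => exact absurd rfl hab
  | cons hadj _ h => exact ⟨_, Finset.mem_insert_of_mem h.left_mem, hadj⟩

end LongCycles

section TwoConnected

variable {V : Type*} [DecidableEq V] {G : SimpleGraph V} [DecidableRel G.Adj] {col : V → Bool}
  {S : Finset V}

lemma linked_of_forall_erase (h2 : ∀ z ∈ S, Linked G (S.erase z)) (hS : 3 ≤ S.card) :
    Linked G S := by
  intro U hU hUne hne
  have hc := Finset.card_sdiff_add_card_eq_card hU
  by_cases h : 2 ≤ (S \ U).card
  · obtain ⟨z, hz⟩ := hne
    have hz' := Finset.mem_sdiff.1 hz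
    obtain ⟨u, hu, v, hv, huv⟩ := h2 z hz'.1 U
      (fun x hx => Finset.mem_erase.2 ⟨fun h => hz'.2 (h ▸ hx), hU hx⟩) hUne (by
        rw [Finset.erase_sdiff_comm, ← Finset.card_pos, Finset.card_erase_of_mem hz]
        omega)
    rw [Finset.mem_sdiff, Finset.mem_erase] at hv
    exact ⟨u, hu, v, Finset.mem_sdiff.2 ⟨hv.1.2, hv.2⟩, huv⟩
  · obtain ⟨z, hz⟩ := hUne
    obtain ⟨u, hu, v, hv, huv⟩ := h2 z (hU hz) (U.erase z) (Finset.erase_subset_erase _ hU)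
      (by rw [← Finset.card_pos, Finset.card_erase_of_mem hz]; omega)
      (by
        obtain ⟨y, hy⟩ := hne
        have hy' := Finset.mem_sdiff.1 hy
        refine ⟨y, Finset.mem_sdiff.2 ⟨Finset.mem_erase.2 ⟨fun h => hy'.2 (h ▸ hz), hy'.1⟩,
          fun h => hy'.2 (Finset.mem_of_mem_erase h)⟩⟩)
    simp only [Finset.mem_sdiff, Finset.mem_erase, not_and] at hu hv
    exact ⟨u, hu.2, v, Finset.mem_sdiff.2 ⟨hv.1.2, hv.2 hv.1.1⟩, huv⟩

lemma Linked.exists_adj (h : Linked G S) (hS : 2 ≤ S.card) {v : V} (hv : v ∈ S) :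
    ∃ u ∈ S, G.Adj v u := by
  obtain ⟨u, hu, x, hx, hux⟩ := h {v} (by simpa using hv) (Finset.singleton_nonempty v) (by
    rw [← Finset.card_pos, Finset.card_sdiff_of_subset (by simpa using hv),
      Finset.card_singleton]
    omega)
  rw [Finset.mem_singleton] at hu
  exact ⟨x, (Finset.mem_sdiff.1 hx).1, hu ▸ hux⟩

/-- Two disjoint sets with few neighbours, in different colour classes, give a long cycle. -/
lemma exists_long_cycle_of_isHallEnd (hcol : ∀ u v, G.Adj u v → col u ≠ col v)
    (h2 : ∀ z ∈ S, Linked G (S.erase z)) (hL : Linked G S) (hpos : ∀ v ∈ S, ∃ u ∈ S, G.Adj v u)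
    {A B A' B' : Finset V} (h : IsHallEnd G S A B) (h' : IsHallEnd G S A' B') (hA : A ⊆ S)
    (hA' : A' ⊆ S) (hne : ∀ a ∈ A, ∀ a' ∈ A', col a ≠ col a')
    (hd : Disjoint (A' ∪ B') (A ∪ B)) :
    ∃ x ∈ S, ∃ y ∈ S, col x ≠ col y ∧
      ∃ C ⊆ S, CycleOn G C ∧ 2 * (degreeIn G S x + degreeIn G S y) ≤ C.card + 2 := by
  have hAne : A.Nonempty := Finset.card_pos.1 (by have := h.card_lt; omega)
  have hAne' : A'.Nonempty := Finset.card_pos.1 (by have := h'.card_lt; omega)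
  have hAB := Finset.union_subset hA h.subset
  have hAB' := Finset.union_subset hA' h'.subset
  obtain ⟨p, hp, q, hq, P, hPS, hP, hPp, hPq⟩ := hL.exists_path hAB' hAB hd
    (hAne'.mono Finset.subset_union_left) (hAne.mono Finset.subset_union_left)
  have hd' := Finset.disjoint_left.1 hd
  have hpq : p ≠ q := fun h => hd' hp (h ▸ hq)
  have hpB : p ∈ B' := by
    refine (Finset.mem_union.1 hp).resolve_left fun hpA => ?_
    obtain ⟨c, hc, hpc⟩ := hP.exists_adj hpq
    exact hpc.ne (hPp c hc (Finset.mem_union_right _ (h'.mem p hpA c (hPS hc) hpc))).symm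
  have hqB : q ∈ B := by
    refine (Finset.mem_union.1 hq).resolve_left fun hqA => ?_
    obtain ⟨c, hc, hqc⟩ := hP.symm.exists_adj hpq.symm
    exact hqc.ne (hPq c hc (Finset.mem_union_right _ (h.mem q hqA c (hPS hc) hqc))).symm
  obtain ⟨x, hx, l, hl, hlp, hlN⟩ := h.exists_path q hqB
  obtain ⟨y, hy, l', hl', hlp', hlN'⟩ := h'.exists_path p hpB
  have hp1 := hlp'.symm.glue hP fun v hv hv' => hPp v hv' (hl' hv)
  obtain ⟨w, n, k, hw, rfl, rfl, hk, hw1, hw2, hwm⟩ := hp1.exists_isPathSeq_glue hlp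
    fun v hv hv' => by
      rcases Finset.mem_union.1 hv with hv | hv
      · exact absurd (hl hv') (hd' (hl' hv))
      · exact hPq v hv (hl hv')
  have hwS : ∀ i < n, w i ∈ S := fun i hi =>
    Finset.union_subset (Finset.union_subset (hl'.trans hAB') hPS) (hl.trans hAB) (hwm i hi)
  refine ⟨w 0, hwS 0 (by omega), w (n - 1), hwS _ (by omega), (hne _ hx _ hy).symm, ?_⟩
  refine exists_long_cycle_of_separated hcol h2 hpos hw hwS (hne _ hx _ hy).symm
    (fun u hu hadj => ?_) (fun u hu hadj => ?_) fun i hi j hj hi' hj' => ?_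
  · obtain ⟨i, hi, hiu⟩ := hw1 u (Finset.mem_union_left _ (hlN' u hu hadj))
    exact ⟨i, by omega, hiu⟩
  · obtain ⟨i, -, hi, hiu⟩ := hw2 u (hlN u hu hadj)
    exact ⟨i, hi, hiu⟩
  · obtain ⟨i', hi1, hi2⟩ := hw1 _ (Finset.mem_union_left _ (hlN' _ (hwS i hi) hi'))
    obtain ⟨j', hj1, hj2, hj3⟩ := hw2 _ (hlN _ (hwS j hj) hj')
    have := hw.eq_of (by omega) hi hi2
    have := hw.eq_of hj2 hj hj3
    omega

/-- A balanced 2-connected bipartite graph with large degree sums has a long cycle. -/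
lemma exists_long_cycle (hcol : ∀ u v, G.Adj u v → col u ≠ col v)
    (h2 : ∀ z ∈ S, Linked G (S.erase z)) {m t : ℕ} (hm : ∀ b, colourCount col b S = m)
    (ht : 2 ≤ t) (htm : t ≤ m)
    (hdeg : ∀ x ∈ S, ∀ y ∈ S, col x ≠ col y → t + 1 ≤ degreeIn G S x + degreeIn G S y) :
    ∃ C ⊆ S, CycleOn G C ∧ 2 * t ≤ C.card := by
  classical
  have hS : S.card = 2 * m := by
    have := colourCount_add col true S
    rw [hm, hm] at this
    omega
  have hL := linked_of_forall_erase h2 (by omega)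
  have hpos : ∀ v ∈ S, ∃ u ∈ S, G.Adj v u := fun v hv => hL.exists_adj (by omega) hv
  suffices H : (∃ x ∈ S, ∃ y ∈ S, col x ≠ col y ∧
      ∃ C ⊆ S, CycleOn G C ∧ 2 * (degreeIn G S x + degreeIn G S y) ≤ C.card + 2) ∨
      ∃ C ⊆ S, CycleOn G C ∧ 2 * t ≤ C.card by
    rcases H with ⟨x, hx, y, hy, hxy, C, hC, hcyc, hcard⟩ | H
    · have := hdeg x hx y hy hxy
      exact ⟨C, hC, hcyc, by omega⟩
    · exact H
  by_cases hPM : HasPerfectMatching G S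
  · obtain ⟨a, b, l, hl, hlS, hab, hN, hring⟩ :=
      hPM.exists_maximal_path hcol (Finset.card_pos.1 (by omega))
    by_cases hr : RingOn G l
    · right
      have hlS' : S \ l = ∅ := by
        by_contra hne
        obtain ⟨u, hu, v, hv, huv⟩ := hL l hlS ⟨a, hl.left_mem⟩
          (Finset.nonempty_iff_ne_empty.2 hne)
        exact hring hr v hv u hu huv
      obtain rfl : l = S := hlS.antisymm (Finset.sdiff_eq_empty_iff_subset.1 hlS')
      exact ⟨l, subset_rfl, hr.cycleOn (by omega), by omega⟩
    · left
      exact ⟨a, hlS hl.left_mem, b, hlS hl.right_mem, hab,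
        exists_long_cycle_of_path hcol h2 hpos hl hlS hab
          (fun u hu h => by_contra fun hul => (hN u (Finset.mem_sdiff.2 ⟨hu, hul⟩)).1 h)
          (fun u hu h => by_contra fun hul => (hN u (Finset.mem_sdiff.2 ⟨hu, hul⟩)).2 h) hr⟩
  · left
    have hvio : ∃ A₀ ⊆ S.filter (col · = true),
        (A₀.biUnion fun x => S.filter (G.Adj x)).card < A₀.card := by
      by_contra hcon
      push Not at hcon
      exact hPM (hasPerfectMatching_of_hall hcol true (by rw [hm, hm]) hcon)
    obtain ⟨A₀, hA₀, hlt⟩ := hvio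
    obtain ⟨A, hAA, B, h⟩ := exists_isHallEnd hcol hA₀ hlt
    have hAX := hAA.trans hA₀
    have hcA : ∀ a ∈ A, a ∈ S ∧ col a = true := fun a ha => Finset.mem_filter.1 (hAX ha)
    have hBY : B ⊆ S.filter (col · = false) := fun b hb => by
      obtain ⟨a, ha, hab⟩ := h.exists_adj b hb
      have h1 := hcol _ _ hab
      rw [(hcA a ha).2] at h1
      exact Finset.mem_filter.2 ⟨h.subset hb, by simpa using h1.symm⟩
    have hlt' : ((S.filter (col · = false) \ B).biUnion fun x => S.filter (G.Adj x)).card <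
        (S.filter (col · = false) \ B).card := by
      have h1 : ((S.filter (col · = false) \ B).biUnion fun x => S.filter (G.Adj x)) ⊆
          S.filter (col · = true) \ A := fun x hx => by
        simp only [Finset.mem_biUnion, Finset.mem_filter, Finset.mem_sdiff] at hx ⊢
        obtain ⟨y, ⟨⟨hyS, hy⟩, hyB⟩, hxS, hyx⟩ := hx
        have h1 := hcol _ _ hyx
        rw [hy] at h1
        exact ⟨⟨hxS, by simpa using h1.symm⟩, fun hxA => hyB (h.mem x hxA y hyS hyx.symm)⟩
      have h2 := Finset.card_le_card h1
      have h3 := Finset.card_sdiff_add_card_eq_card hAX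
      have h4 := Finset.card_sdiff_add_card_eq_card hBY
      have h5 : (S.filter (col · = true)).card = m := hm true
      have h6 : (S.filter (col · = false)).card = m := hm false
      have := h.card_lt
      omega
    obtain ⟨A', hAA', B', h'⟩ := exists_isHallEnd hcol Finset.sdiff_subset hlt'
    have hcA' : ∀ a ∈ A', (a ∈ S ∧ col a = false) ∧ a ∉ B := fun a ha => by
      simpa only [Finset.mem_sdiff, Finset.mem_filter] using hAA' ha
    refine exists_long_cycle_of_isHallEnd hcol h2 hL hpos h h' (fun a ha => (hcA a ha).1)
      (fun a ha => (hcA' a ha).1.1)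
      (fun a ha a' ha' => by simp [(hcA a ha).2, (hcA' a' ha').1.2]) ?_
    have hcB : ∀ b ∈ B, col b = false := fun b hb => (Finset.mem_filter.1 (hBY hb)).2
    rw [Finset.disjoint_left]
    intro v hv hv'
    rcases Finset.mem_union.1 hv with hv | hv
    · rcases Finset.mem_union.1 hv' with hv' | hv'
      · have h1 := (hcA v hv').2
        rw [(hcA' v hv).1.2] at h1
        exact absurd h1 (by decide)
      · exact (hcA' v hv).2 hv'
    · obtain ⟨a', ha', hav⟩ := h'.exists_adj v hv
      rcases Finset.mem_union.1 hv' with hv' | hv'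
      · exact (hcA' a' ha').2 (h.mem v hv' a' (hcA' a' ha').1.1 hav.symm)
      · exact hcol _ _ hav ((hcA' a' ha').1.2.trans (hcB v hv').symm)

end TwoConnected

section Extremal

lemma cut_vertex_bound_aux {T u v k e₁ e₂ : ℤ} (hu : 0 ≤ u) (hv : 1 ≤ v) (hk : 1 ≤ k)
    (hT : u + v + k ≤ 2 * T) (h₁ : e₁ ≤ (u + k + 1) * u) (h₁' : e₁ ≤ T * (u + k) + u)
    (h₂ : e₂ ≤ v * (v + k)) (h₂' : e₂ ≤ T * (v + k - 1) + v) :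
    e₁ + e₂ ≤ T * (u + v + k - 1) + (u + v + k) := by
  rcases lt_or_ge T u with h | hTu
  · nlinarith [mul_nonneg (sub_nonneg.2 hv) (show 0 ≤ T - v - k by omega)]
  rcases lt_or_ge T v with h | hTv
  · nlinarith [mul_nonneg hu (show 0 ≤ T - u - k by omega)]
  have hs : 0 ≤ u + v + k - 1 := by omega
  rcases lt_or_ge k (u - v) with h | h
  · nlinarith [mul_nonneg (sub_nonneg.2 hv) (show 0 ≤ u - v - k by omega),
      mul_nonneg (sub_nonneg.2 hTu) hs]
  rcases lt_or_ge k (v - u) with h' | h'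
  · nlinarith [mul_nonneg hu (show 0 ≤ v - u - k by omega), mul_nonneg (sub_nonneg.2 hTv) hs]
  · nlinarith [mul_nonneg (show 0 ≤ k - (u - v) by omega) (show 0 ≤ k + u - v + 1 by omega),
      mul_nonneg (sub_nonneg.2 hT) hs]

lemma cut_vertex_bound {T m a₁ a₂ b₁ b₂ e₁ e₂ : ℕ} (hm : m ≤ 2 * T) (ha : a₁ + a₂ = m + 1)
    (hb : b₁ + b₂ = m) (ha₁ : 1 ≤ a₁) (ha₂ : 1 ≤ a₂) (h₁ : e₁ ≤ a₁ * b₁) (h₂ : e₂ ≤ a₂ * b₂)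
    (h₁' : a₁ ≤ b₁ → e₁ ≤ T * (b₁ - 1) + a₁) (h₁'' : b₁ ≤ a₁ → e₁ ≤ T * (a₁ - 1) + b₁)
    (h₂' : a₂ ≤ b₂ → e₂ ≤ T * (b₂ - 1) + a₂) (h₂'' : b₂ ≤ a₂ → e₂ ≤ T * (a₂ - 1) + b₂) :
    e₁ + e₂ ≤ T * (m - 1) + m := by
  have key : ∀ {u v k e e' : ℕ}, 1 ≤ v → 1 ≤ k → u + v + k = m → e ≤ (u + k + 1) * u →
      e ≤ T * (u + k) + u → e' ≤ v * (v + k) → e' ≤ T * (v + k - 1) + v →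
      e + e' ≤ T * (m - 1) + m := by
    rintro u v k e e' hv hk rfl h1 h2 h3 h4
    have := cut_vertex_bound_aux (T := T) (u := u) (v := v) (k := k) (e₁ := e) (e₂ := e')
      (by omega) (by omega) (by omega) (by omega) (by exact_mod_cast h1) (by exact_mod_cast h2)
      (by exact_mod_cast h3) (by
        zify [show 1 ≤ v + k by omega] at h4
        exact h4)
    zify [show 1 ≤ u + v + k by omega]
    exact this
  rcases le_or_gt b₁ a₁ with hba | hab
  · rcases le_or_gt b₂ a₂ with hba' | hab'
    · have h3 := h₁'' hba
      have h4 := h₂'' hba'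
      have : T * (a₁ - 1) + T * (a₂ - 1) = T * (m - 1) := by
        rw [← Nat.mul_add]
        congr 1
        omega
      omega
    · have h3 := h₁'' hba
      have h4 := h₂' hab'.le
      obtain ⟨k, rfl⟩ := Nat.exists_eq_add_of_lt hab'
      obtain rfl : a₁ = b₁ + (k + 1) + 1 := by omega
      exact key (k := k + 1) ha₂ (by omega) (by omega) h₁ h3 h₂ h4
  · have h3 := h₁' hab.le
    have h4 := h₂'' (by omega)
    obtain ⟨k, rfl⟩ := Nat.exists_eq_add_of_lt hab
    obtain rfl : a₂ = b₂ + (k + 1) + 1 := by omega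
    rw [add_comm e₁]
    exact key (k := k + 1) ha₁ (by omega) (by omega) h₂ h4 h₁ h3

variable {V : Type*} [DecidableEq V] {G : SimpleGraph V} [DecidableRel G.Adj] {col : V → Bool}
  {S : Finset V} {T m : ℕ}

lemma degreeSum_insert {z : V} {U : Finset V} (hz : z ∉ U) :
    degreeSum G (insert z U) = degreeSum G U + 2 * degreeIn G U z := by
  have h := degreeSum_erase (G := G) (Finset.mem_insert_self z U)
  rw [← degreeIn_erase_self, Finset.erase_insert hz] at h
  exact h.symm

/-- The bound on the number of edges inside `S` which is to be proved for sets without a cycle of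
length `2 * (T + 1)`. -/
def IsSparse (G : SimpleGraph V) [DecidableRel G.Adj] (col : V → Bool) (T : ℕ)
    (S : Finset V) : Prop :=
  ∀ b, colourCount col b S ≤ colourCount col (!b) S → colourCount col b S ≤ 2 * T →
    degreeSum G S ≤ 2 * (T * (colourCount col (!b) S - 1) + colourCount col b S)

lemma isSparse_of_lt (hcol : ∀ u v, G.Adj u v → col u ≠ col v) (hT : 1 ≤ T)
    (ih : ∀ S' ⊂ S, IsSparse G col T S') (b : Bool)
    (hlt : colourCount col b S < colourCount col (!b) S) (hb : colourCount col b S ≤ 2 * T) :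
    degreeSum G S ≤ 2 * (T * (colourCount col (!b) S - 1) + colourCount col b S) := by
  have hmul := degreeSum_le_mul hcol S b
  have herase : ∀ y ∈ S, col y = !b → colourCount col b (S.erase y) = colourCount col b S ∧
      colourCount col (!b) (S.erase y) + 1 = colourCount col (!b) S := fun y hy hyb => by
    have h1 := colourCount_erase (col := col) hy b
    have h2 := colourCount_erase (col := col) hy (!b)
    rw [hyb] at h1 h2
    simp only [Bool.not_eq_self, if_false, if_true] at h1 h2
    exact ⟨h1, h2⟩
  have hih : ∀ y ∈ S, col y = !b → degreeSum G (S.erase y) ≤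
      2 * (T * (colourCount col (!b) S - 2) + colourCount col b S) := fun y hy hyb => by
    obtain ⟨h1, h2⟩ := herase y hy hyb
    have h3 := ih _ (Finset.erase_ssubset hy) b (by omega) (by omega)
    rwa [h1, show colourCount col (!b) (S.erase y) - 1 = colourCount col (!b) S - 2 by omega] at h3
  generalize hn : colourCount col (!b) S = n at *
  generalize colourCount col b S = m at *
  rcases Nat.lt_or_ge n 2 with hn2 | hn2
  · obtain rfl : m = 0 := by omega
    omega
  obtain ⟨n, rfl⟩ := Nat.exists_eq_add_of_le hn2
  rw [show 2 + n - 2 = n by omega] at hih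
  rw [show 2 + n - 1 = n + 1 by omega]
  by_cases hy : ∃ y ∈ S, col y = !b ∧ degreeIn G S y ≤ T
  · obtain ⟨y, hyS, hyb, hyd⟩ := hy
    have h1 := hih y hyS hyb
    have h2 := degreeSum_erase (G := G) hyS
    nlinarith
  · push Not at hy
    obtain ⟨y, hyY⟩ := Finset.card_pos.1 (show 0 < (S.filter (col · = !b)).card by
      unfold colourCount at hn
      omega)
    obtain ⟨hyS, hyb⟩ := Finset.mem_filter.1 hyY
    have h1 := hih y hyS hyb
    have h2 := degreeSum_erase (G := G) hyS
    have h3 := degreeSum_eq_two_mul hcol S (!b)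
    rw [← Finset.add_sum_erase _ _ hyY] at h3
    have h4 := Finset.card_nsmul_le_sum ((S.filter (col · = !b)).erase y) (degreeIn G S) (T + 1)
      fun x hx => by
        obtain ⟨hxS, hxb⟩ := Finset.mem_filter.1 (Finset.mem_of_mem_erase hx)
        exact hy x hxS hxb
    rw [Finset.card_erase_of_mem hyY, show (S.filter (col · = !b)).card = 2 + n from hn,
      smul_eq_mul, show 2 + n - 1 = n + 1 by omega] at h4
    nlinarith

lemma linked_erase_of_isSparse (hcol : ∀ u v, G.Adj u v → col u ≠ col v)
    (ih : ∀ S' ⊂ S, IsSparse G col T S') (hm : ∀ b, colourCount col b S = m) (hmT : m ≤ 2 * T)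
    (he : 2 * (T * (m - 1) + m) < degreeSum G S) {z : V} (hz : z ∈ S) :
    Linked G (S.erase z) := by
  intro U hU hUne hWne
  by_contra hcon
  push Not at hcon
  set W := S.erase z \ U with hW
  have hzU : z ∉ U := fun h => (Finset.mem_erase.1 (hU h)).1 rfl
  have hzW : z ∉ W := fun h => (Finset.mem_erase.1 (Finset.mem_sdiff.1 h).1).1 rfl
  have hd : Disjoint U W := Finset.disjoint_sdiff
  have hUW : U ∪ W = S.erase z := Finset.union_sdiff_of_subset hU
  have hdeg : degreeSum G (insert z U) + degreeSum G (insert z W) = degreeSum G S := by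
    have h1 := degreeSum_union hd hcon
    have h2 := degreeSum_erase (G := G) hz
    have h3 := degreeIn_union hd (G := G) z
    rw [hUW] at h1 h3
    rw [degreeIn_erase_self] at h3
    rw [degreeSum_insert hzU, degreeSum_insert hzW]
    omega
  have hcount : ∀ b, colourCount col b (insert z U) + colourCount col b (insert z W) =
      m + if col z = b then 1 else 0 := fun b => by
    have h1 := colourCount_union (col := col) hd b
    have h2 := colourCount_erase (col := col) hz b
    rw [hUW] at h1
    rw [hm b] at h2
    rw [colourCount_insert hzU, colourCount_insert hzW]
    omega
  have hzS : ∀ U' W' : Finset V, U' ∪ W' = S.erase z → Disjoint U' W' → W'.Nonempty →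
      insert z U' ⊂ S := fun U' W' h hd hne => by
    obtain ⟨x, hx⟩ := hne
    have hx' := Finset.mem_erase.1 (h ▸ Finset.mem_union_right U' hx)
    refine (Finset.ssubset_iff_of_subset (Finset.insert_subset hz fun y hy =>
      Finset.mem_of_mem_erase (h ▸ Finset.mem_union_left W' hy))).2 ⟨x, hx'.2, fun h => ?_⟩
    rcases Finset.mem_insert.1 h with h | h
    · exact hx'.1 h
    · exact Finset.disjoint_left.1 hd h hx
  have hU1 := hzS U W hUW hd hWne
  have hW1 := hzS W U (by rw [Finset.union_comm, hUW]) hd.symm hUne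
  have c1 := hcount (col z)
  have c2 := hcount (!col z)
  rw [if_pos rfl] at c1
  rw [if_neg (by simp)] at c2
  have i1 := ih _ hU1 (col z)
  have i2 := ih _ hU1 (!col z)
  have i3 := ih _ hW1 (col z)
  have i4 := ih _ hW1 (!col z)
  rw [Bool.not_not] at i2 i4
  have p1 := degreeSum_le_mul hcol (insert z U) (col z)
  have p2 := degreeSum_le_mul hcol (insert z W) (col z)
  have q1 := colourCount_insert (col := col) hzU (col z)
  have q2 := colourCount_insert (col := col) hzW (col z)
  rw [if_pos rfl] at q1 q2
  obtain ⟨e₁, he₁⟩ : ∃ e, degreeSum G (insert z U) = 2 * e := ⟨_, degreeSum_eq_two_mul hcol _ true⟩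
  obtain ⟨e₂, he₂⟩ : ∃ e, degreeSum G (insert z W) = 2 * e := ⟨_, degreeSum_eq_two_mul hcol _ true⟩
  rw [he₁] at i1 i2 p1 hdeg
  rw [he₂] at i3 i4 p2 hdeg
  have := cut_vertex_bound hmT c1 (c2.trans (add_zero m)) (by omega) (by omega) (e₁ := e₁)
    (e₂ := e₂) (by omega) (by omega) (fun h => by have := i1 h (by omega); omega)
    (fun h => by have := i2 h (by omega); omega) (fun h => by have := i3 h (by omega); omega)
    (fun h => by have := i4 h (by omega); omega)
  omega

lemma exists_isLongestSeq {C : Finset V} (hC : C ⊆ S) (h : CycleOn G C) :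
    ∃ v n, C.card ≤ n ∧ IsLongestSeq G S v n := by
  classical
  obtain ⟨D, hD, hmax⟩ := Finset.exists_max_image (S.powerset.filter (CycleOn G)) Finset.card
    ⟨C, Finset.mem_filter.2 ⟨Finset.mem_powerset.2 hC, h⟩⟩
  rw [Finset.mem_filter, Finset.mem_powerset] at hD
  obtain ⟨v, hv, hvD⟩ := hD.2.exists_seq
  have hle : ∀ s ⊆ S, CycleOn G s → s.card ≤ D.card := fun s hs hcs =>
    hmax s (Finset.mem_filter.2 ⟨Finset.mem_powerset.2 hs, hcs⟩)
  exact ⟨v, D.card, hle C hC h, hv,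
    fun i => hD.1 (hvD.subset (hv.mem_image_range i)), hle⟩

lemma isSparse_of_not_hasCycle (hcol : ∀ u v, G.Adj u v → col u ≠ col v) (hT : 1 ≤ T)
    (S : Finset V) (hno : ¬ HasCycle G S (2 * (T + 1))) : IsSparse G col T S := by
  induction S using Finset.strongInduction with
  | H S ih =>
  replace ih : ∀ S' ⊂ S, IsSparse G col T S' := fun S' hS' =>
    ih S' hS' fun h => hno (h.mono hS'.subset)
  intro b hb hbT
  rcases hb.lt_or_eq with hlt | heq
  · exact isSparse_of_lt hcol hT ih b hlt hbT
  obtain ⟨m, hm⟩ : ∃ m, ∀ c, colourCount col c S = m := ⟨colourCount col b S, fun c => by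
    rcases Bool.eq_or_eq_not c b with rfl | rfl
    · rfl
    · exact heq.symm⟩
  rw [hm] at hbT
  rw [hm, hm]
  by_contra! he
  have hTm : T + 1 ≤ m := by
    by_contra! hmT
    have h1 := degreeSum_le_mul hcol S true
    rw [hm, hm] at h1
    rcases Nat.eq_zero_or_pos m with rfl | hm0
    · omega
    · obtain ⟨l, rfl⟩ := Nat.exists_eq_add_of_le' hm0
      rw [Nat.add_sub_cancel] at he
      nlinarith [Nat.mul_le_mul_right l (show l + 1 ≤ T by omega)]
  obtain ⟨C, hC, hcyc, hcard⟩ := exists_long_cycle hcol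
    (fun z hz => linked_erase_of_isSparse hcol ih hm hbT he hz) hm (t := T + 1) (by omega) hTm
    fun x hx y hy hxy => by
      by_contra! hd
      have hne : x ≠ y := fun h => hxy (by rw [h])
      have h1 := degreeSum_erase_erase (G := G) hx hy hne
      have hy' : y ∈ S.erase x := Finset.mem_erase.2 ⟨hne.symm, hy⟩
      have h2 : ∀ c, colourCount col c ((S.erase x).erase y) + 1 = m := fun c => by
        have h3 := colourCount_erase (col := col) hx c
        have h4 := colourCount_erase (col := col) hy' c
        rw [hm] at h3
        rcases Bool.eq_or_eq_not c (col x) with rfl | rfl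
        · rw [if_pos rfl] at h3
          rw [if_neg hxy.symm] at h4
          omega
        · rw [if_neg (by simp)] at h3
          rw [if_pos (Bool.eq_not_of_ne hxy.symm)] at h4
          omega
      have h3 := h2 true
      have h4 := h2 false
      have h5 := ih _ ((Finset.erase_ssubset hy').trans (Finset.erase_ssubset hx)) true
        (by simp only [Bool.not_true]; omega) (by omega)
      rw [Bool.not_true, show colourCount col false ((S.erase x).erase y) - 1 = m - 2 by omega,
        show colourCount col true ((S.erase x).erase y) = m - 1 by omega] at h5
      obtain ⟨l, rfl⟩ := Nat.exists_eq_add_of_le' (show 2 ≤ m by omega)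
      rw [show l + 2 - 1 = l + 1 by omega] at he h5
      rw [Nat.add_sub_cancel] at h5
      rw [Nat.mul_succ] at he
      omega
  obtain ⟨v, n, hn, hv⟩ := exists_isLongestSeq hC hcyc
  obtain ⟨c, rfl⟩ := Nat.dvd_of_mod_eq_zero (hv.toIsCyclicSeq.even hcol)
  refine hno (hv.hasCycle hcol (t := T + 1) (by omega) (by omega) hm (by omega) ?_)
  obtain ⟨l, rfl⟩ := Nat.exists_eq_add_of_le' (show 1 ≤ m by omega)
  rw [Nat.add_sub_cancel] at he
  nlinarith [Nat.mul_le_mul_right l hbT]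

end Extremal

/-- **Theorem (Li–Ning).** Let `t` be an integer and `G = (X,Y;E)` a bipartite graph with
`|X| = m`, `|Y| = n`. Suppose `n ≥ m` and `t ≤ m ≤ 2t - 2`. If `e(G) > (t-1)(n-1) + m`,
then `G` contains a cycle of length exactly `2t`. -/
theorem stmt_0 {V : Type} [Fintype V] [DecidableEq V]
    (G : SimpleGraph V) (X Y : Finset V) (m n t : ℕ)
    (hpart : ∀ v : V, v ∈ X ∨ v ∈ Y) (hdisj : Disjoint X Y)
    (hbip : ∀ u v : V, G.Adj u v → (u ∈ X ∧ v ∈ Y) ∨ (u ∈ Y ∧ v ∈ X))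
    (hm : X.card = m) (hn : Y.card = n)
    (hnm : m ≤ n) (htm : t ≤ m) (hm2t : m + 2 ≤ 2 * t)
    (he : (t - 1) * (n - 1) + m < G.edgeSet.ncard) :
    ∃ (v : V) (w : G.Walk v v), w.IsCycle ∧ w.length = 2 * t := by
  classical
  have hXY : ∀ v, v ∈ Y ↔ v ∉ X := fun v =>
    ⟨fun h h' => Finset.disjoint_left.1 hdisj h' h, (hpart v).resolve_left⟩
  set col : V → Bool := fun v => decide (v ∈ X) with hc
  have hcol : ∀ u v, G.Adj u v → col u ≠ col v := fun u v huv => by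
    rcases hbip u v huv with ⟨h1, h2⟩ | ⟨h1, h2⟩
    · simp [hc, h1, (hXY v).1 h2]
    · simp [hc, h2, (hXY u).1 h1]
  have hX : colourCount col true Finset.univ = m := by
    rw [← hm, colourCount]
    congr 1
    ext v
    simp [hc]
  have hY : colourCount col false Finset.univ = n := by
    rw [← hn, colourCount]
    congr 1
    ext v
    simp [hc, hXY]
  have hE : degreeSum G Finset.univ = 2 * G.edgeSet.ncard := by
    rw [Set.ncard_eq_toFinset_card', ← SimpleGraph.edgeFinset, ← G.sum_degrees_eq_twice_card_edges]
    refine Finset.sum_congr rfl fun v _ => ?_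
    rw [degreeIn, ← SimpleGraph.neighborFinset_eq_filter, SimpleGraph.card_neighborFinset_eq_degree]
  suffices h : HasCycle G Finset.univ (2 * (t - 1 + 1)) by
    obtain ⟨s, -, hs, hcard⟩ := h
    obtain ⟨v, w, hw, hl⟩ := hs.exists_isCycle
    exact ⟨v, w, hw, by omega⟩
  by_contra hno
  have h := isSparse_of_not_hasCycle hcol (T := t - 1) (by omega) _ hno true
    (by rw [Bool.not_true, hX, hY]; exact hnm) (by omega)
  rw [Bool.not_true, hX, hY, hE] at h
  omega
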